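/- Let M be a Riemannian three-manifold carrying a unit Killing field ξ and let p ∈ M. The following three assertions are equivalent: (i) M admits a totally geodesic surface passing through p which is neither orthogonal nor tangent to ξ at p; (ii) in a neighborhood of p there is an orthogonal decomposition ξ = X₁ + X₂ where X₁ and X₂ are Killing fields without zeros that commute; (iii) there exist local coordinates (x,y,z) around p with ξ = ∂_y + ∂_z in which the metric takes the form g = dx² + sin²θ(x) dy² + cos²θ(x) dz² for some function θ of x alone. -/

import Mathlib

noncomputable section
open Real Set

/-- Points of the coordinate chart `ℝⁿ`. -/
abbrev Pt (n : ℕ) := Fin n → ℝ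

/-- The `i`-th standard coordinate vector. -/
def stdb (n : ℕ) (i : Fin n) : Pt n := Pi.single i 1

/-- Riemannian metric data in coordinates: a field of symmetric bilinear forms. -/
abbrev Met (n : ℕ) := Pt n → Fin n → Fin n → ℝ

/-- The inner product of the vectors `v`, `w` at the point `x`, with respect to `g`. -/
def minner {n : ℕ} (g : Met n) (x v w : Pt n) : ℝ := ∑ i, ∑ j, g x i j * v i * w j

/-- `g` is a smooth Riemannian metric on `U`. -/
def IsMetricOn {n : ℕ} (U : Set (Pt n)) (g : Met n) : Prop :=
  (∀ i j, ContDiffOn ℝ (⊤ : ℕ∞) (fun x => g x i j) U) ∧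
  (∀ x i j, g x i j = g x j i) ∧
  (∀ x ∈ U, ∀ v : Pt n, v ≠ 0 → 0 < minner g x v v)

/-- The inverse metric `g^{kl}`. -/
def ginv {n : ℕ} (g : Met n) (x : Pt n) : Fin n → Fin n → ℝ :=
  fun k l => (Matrix.of (g x))⁻¹ k l

/-- The Christoffel symbols `Γᵏᵢⱼ` of the Levi-Civita connection of `g`. -/
def christoffel {n : ℕ} (g : Met n) (x : Pt n) (k i j : Fin n) : ℝ :=
  (1/2) * ∑ l, ginv g x k l *
    (fderiv ℝ (fun y => g y j l) x (stdb n i) + fderiv ℝ (fun y => g y i l) x (stdb n j)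
      - fderiv ℝ (fun y => g y i j) x (stdb n l))

/-- The covariant derivative (Levi-Civita connection of `g`) of the vector field `Y`
at the point `x` in the direction `v`. -/
def covD {n : ℕ} (g : Met n) (Y : Pt n → Pt n) (x v : Pt n) : Pt n :=
  fun k => fderiv ℝ (fun y => Y y k) x v + ∑ i, ∑ j, christoffel g x k i j * v i * Y x j

/-- `X` is a Killing field of `g` on `U`. -/
def IsKillingOn {n : ℕ} (U : Set (Pt n)) (g : Met n) (X : Pt n → Pt n) : Prop :=
  ∀ x ∈ U, ∀ v w : Pt n,
    minner g x (covD g X x v) w + minner g x (covD g X x w) v = 0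

/-- `X` has unit length on `U`. -/
def IsUnitOn {n : ℕ} (U : Set (Pt n)) (g : Met n) (X : Pt n → Pt n) : Prop :=
  ∀ x ∈ U, minner g x (X x) (X x) = 1

/-- The Lie bracket `[X,Y]` of two vector fields, in coordinates. -/
def lieB {n : ℕ} (X Y : Pt n → Pt n) (x : Pt n) : Pt n :=
  fun k => fderiv ℝ (fun y => Y y k) x (X x) - fderiv ℝ (fun y => X y k) x (Y x)

/-- A parametrized hypersurface `F : V → ℝ^{n+1}` with a chosen unit normal field `N`. -/
structure Hyp (n : ℕ) where
  V : Set (Pt n)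
  F : Pt n → Pt (n+1)
  N : Pt n → Pt (n+1)

/-- The ambient covariant derivative, along the map `F`, of the ambient-vector-valued
field `W` defined on the parameter domain, in the coordinate direction `v`. -/
def covAlong {n : ℕ} (g : Met (n+1)) (F W : Pt n → Pt (n+1)) (u v : Pt n) : Pt (n+1) :=
  fun k => fderiv ℝ (fun y => W y k) u v +
    ∑ i, ∑ j, christoffel g (F u) k i j * fderiv ℝ F u v i * W u j

/-- `S` is a smooth immersed hypersurface inside the chart `U`, with unit normal `N`. -/
def Hyp.IsRegular {n : ℕ} (S : Hyp n) (U : Set (Pt (n+1))) (g : Met (n+1)) : Prop :=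
  IsOpen S.V ∧ ContDiffOn ℝ (⊤ : ℕ∞) S.F S.V ∧ (∀ u ∈ S.V, S.F u ∈ U) ∧
  (∀ u ∈ S.V, LinearIndependent ℝ (fun a : Fin n => fderiv ℝ S.F u (stdb n a))) ∧
  ContDiffOn ℝ (⊤ : ℕ∞) S.N S.V ∧
  (∀ u ∈ S.V, minner g (S.F u) (S.N u) (S.N u) = 1) ∧
  (∀ u ∈ S.V, ∀ a : Fin n, minner g (S.F u) (S.N u) (fderiv ℝ S.F u (stdb n a)) = 0)

/-- `S` is totally geodesic: the shape operator `X ↦ -∇̃_X N` vanishes. -/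
def Hyp.TotallyGeodesic {n : ℕ} (S : Hyp n) (g : Met (n+1)) : Prop :=
  ∀ u ∈ S.V, ∀ a : Fin n, covAlong g S.F S.N u (stdb n a) = 0

/-- `S` is totally umbilical: the shape operator `X ↦ -∇̃_X N` is pointwise a
multiple of the identity. -/
def Hyp.TotallyUmbilical {n : ℕ} (S : Hyp n) (g : Met (n+1)) : Prop :=
  ∃ lam : Pt n → ℝ, ∀ u ∈ S.V, ∀ a : Fin n,
    covAlong g S.F S.N u (stdb n a) = lam u • fderiv ℝ S.F u (stdb n a)

/-- Projection onto the first `n` coordinates. -/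
def projBase {n : ℕ} (x : Pt (n+1)) : Pt n := fun i => x i.castSucc

/-- The product metric of `g₀` with the Euclidean line (last coordinate). -/
def prodMet {n : ℕ} (g₀ : Met n) : Met (n+1) := fun x i j =>
  Fin.lastCases (Fin.lastCases 1 (fun _ => 0) j)
    (fun i' => Fin.lastCases 0 (fun j' => g₀ (projBase x) i' j') j) i

/-- The coordinate domain of a product `𝕄 × I`. -/
def prodDom {n : ℕ} (U₀ : Set (Pt n)) (I : Set ℝ) : Set (Pt (n+1)) :=
  {x | projBase x ∈ U₀ ∧ x (Fin.last n) ∈ I}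

/-- The unit vertical field `ξ` of a product `𝕄 × I`. -/
def vert (n : ℕ) : Pt (n+1) → Pt (n+1) := fun _ => stdb (n+1) (Fin.last n)

/-- The pullback of the metric `g` under the map `Φ`. -/
def pullMet {n : ℕ} (g : Met n) (Φ : Pt n → Pt n) : Met n :=
  fun x i j => minner g (Φ x) (fderiv ℝ Φ x (stdb n i)) (fderiv ℝ Φ x (stdb n j))

/-- `g` has, on the coordinate domain `W`, the shape `dt² + f(t)² g_M` of a warped
product of an interval (the `0`-th coordinate) with an `n`-dimensional manifold. -/
def IsWarpedForm {n : ℕ} (g : Met (n+1)) (W : Set (Pt (n+1))) : Prop :=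
  ∃ f : ℝ → ℝ, ContDiff ℝ (⊤ : ℕ∞) f ∧ (∀ t, 0 < f t) ∧
    ∀ x ∈ W, g x 0 0 = 1 ∧
      (∀ i : Fin (n+1), i ≠ 0 → g x 0 i = 0 ∧ g x i 0 = 0) ∧
      (∀ i j : Fin (n+1), i ≠ 0 → j ≠ 0 →
        fderiv ℝ (fun y => g y i j / f (y 0) ^ 2) x (stdb (n+1) 0) = 0)

/-- The Riemannian manifold `(U₀, g₀)` has, in a neighborhood of `p`, the structure of a
warped product of an interval of the Euclidean line with an `n`-dimensional manifold:
there is a diffeomorphism `Φ` from a coordinate domain `W` onto a neighborhood of `p`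
pulling `g₀` back to a warped-product metric. -/
def LocallyWarpedAt {n : ℕ} (U₀ : Set (Pt (n+1))) (g₀ : Met (n+1)) (p : Pt (n+1)) : Prop :=
  ∃ (W : Set (Pt (n+1))) (Φ Ψ : Pt (n+1) → Pt (n+1)),
    IsOpen W ∧ ContDiffOn ℝ (⊤ : ℕ∞) Φ W ∧ MapsTo Φ W U₀ ∧
    IsOpen (Φ '' W) ∧ p ∈ Φ '' W ∧
    ContDiffOn ℝ (⊤ : ℕ∞) Ψ (Φ '' W) ∧ (∀ w ∈ W, Ψ (Φ w) = w) ∧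
    IsWarpedForm (pullMet g₀ Φ) W

/-- The Levi-Civita symbol on three indices. -/
def lcSymb (i j k : Fin 3) : ℝ :=
  ((j.val : ℝ) - (i.val : ℝ)) * ((k.val : ℝ) - (i.val : ℝ)) * ((k.val : ℝ) - (j.val : ℝ)) / 2

/-- The cross product of `v` and `w` at `x`, with respect to the metric `g` and the
orientation of the chart. -/
def crossG (g : Met 3) (x v w : Pt 3) : Pt 3 :=
  fun k => Real.sqrt (Matrix.det (Matrix.of (g x))) *
    ∑ l, ginv g x k l * ∑ i, ∑ j, lcSymb l i j * v i * w j

/-- The components `Rˡᵢⱼₖ` of the Riemann curvature tensor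
(`R(∂ᵢ,∂ⱼ)∂ₖ = Rˡᵢⱼₖ ∂ₗ`, with `R(X,Y) = ∇_X∇_Y - ∇_Y∇_X - ∇_{[X,Y]}`). -/
def riem {n : ℕ} (g : Met n) (x : Pt n) (l i j k : Fin n) : ℝ :=
  fderiv ℝ (fun y => christoffel g y l j k) x (stdb n i)
  - fderiv ℝ (fun y => christoffel g y l i k) x (stdb n j)
  + ∑ m, (christoffel g x l i m * christoffel g x m j k
      - christoffel g x l j m * christoffel g x m i k)

/-- The curvature operator `R(v,w)z` at `x`. -/
def riemVec {n : ℕ} (g : Met n) (x v w z : Pt n) : Pt n :=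
  fun l => ∑ i, ∑ j, ∑ k, riem g x l i j k * v i * w j * z k

/-- `g` has constant sectional curvature `c` on `W`. -/
def HasConstCurv {n : ℕ} (W : Set (Pt n)) (g : Met n) (c : ℝ) : Prop :=
  ∀ x ∈ W, ∀ v w : Pt n,
    minner g x (riemVec g x v w w) v
      = c * (minner g x v v * minner g x w w - (minner g x v w) ^ 2)

/-- The Ricci tensor of `g`. -/
def ricci {n : ℕ} (g : Met n) (x : Pt n) (j k : Fin n) : ℝ := ∑ i, riem g x i i j k

/-- The scalar curvature of `g`. -/
def scal {n : ℕ} (g : Met n) (x : Pt n) : ℝ := ∑ j, ∑ k, ginv g x j k * ricci g x j k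

/-- The metric `dx² + sin²θ(x) dy² + cos²θ(x) dz²` on a three-dimensional chart. -/
def tgMet (θ : ℝ → ℝ) : Met 3 := fun x i j =>
  if i = j then
    (if i = 0 then 1 else if i = 1 then (Real.sin (θ (x 0))) ^ 2 else (Real.cos (θ (x 0))) ^ 2)
  else 0

/-- The warped product metric `dt² + f(t)² g₀` (interval coordinate first). -/
def warpMet {n : ℕ} (f : ℝ → ℝ) (g₀ : Met n) : Met (n+1) := fun x i j =>
  Fin.cases (Fin.cases 1 (fun _ => 0) j)
    (fun i' => Fin.cases 0 (fun j' => f (x 0) ^ 2 * g₀ (Fin.tail x) i' j') j) i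

/-- The coordinate domain of a warped product `I ×_f 𝕄` (interval coordinate first). -/
def warpDom {n : ℕ} (I : Set ℝ) (U₀ : Set (Pt n)) : Set (Pt (n+1)) :=
  {x | x 0 ∈ I ∧ Fin.tail x ∈ U₀}

/-- The covariant acceleration of a curve `γ`, whose vanishing defines geodesics. -/
def curveAccel {n : ℕ} (g : Met n) (γ : ℝ → Pt n) (s : ℝ) : Pt n :=
  fun k => deriv (fun t => deriv (fun r => γ r k) t) s +
    ∑ i, ∑ j, christoffel g (γ s) k i j * deriv (fun r => γ r i) s * deriv (fun r => γ r j) s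

/-- The velocity of a curve. -/
def vel {n : ℕ} (γ : ℝ → Pt n) (s : ℝ) : Pt n := fun k => deriv (fun r => γ r k) s

/-- Assertion (i) of Theorem 2 (3): `M` admits a totally geodesic surface through `p`
which is neither orthogonal nor tangent to `ξ` at `p`. -/
def AssertionI (U : Set (Pt 3)) (g : Met 3) (ξ : Pt 3 → Pt 3) (p : Pt 3) : Prop :=
  ∃ S : Hyp 2, S.IsRegular U g ∧ S.TotallyGeodesic g ∧
    ∃ u ∈ S.V, S.F u = p ∧
      -- not tangent at `p`:
      minner g p (ξ p) (S.N u) ≠ 0 ∧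
      -- not orthogonal at `p`:
      (∃ a : Fin 2, minner g p (ξ p) (fderiv ℝ S.F u (stdb 2 a)) ≠ 0)

/-- Assertion (ii) of Theorem 2 (3): near `p` there is an orthogonal decomposition
`ξ = X₁ + X₂` where `X₁`, `X₂` are commuting Killing fields without zeros. -/
def AssertionII (U : Set (Pt 3)) (g : Met 3) (ξ : Pt 3 → Pt 3) (p : Pt 3) : Prop :=
  ∃ W : Set (Pt 3), IsOpen W ∧ p ∈ W ∧ W ⊆ U ∧
    ∃ X₁ X₂ : Pt 3 → Pt 3,
      ContDiffOn ℝ (⊤ : ℕ∞) X₁ W ∧ ContDiffOn ℝ (⊤ : ℕ∞) X₂ W ∧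
      (∀ x ∈ W, X₁ x + X₂ x = ξ x) ∧
      (∀ x ∈ W, minner g x (X₁ x) (X₂ x) = 0) ∧
      (∀ x ∈ W, X₁ x ≠ 0) ∧ (∀ x ∈ W, X₂ x ≠ 0) ∧
      IsKillingOn W g X₁ ∧ IsKillingOn W g X₂ ∧
      (∀ x ∈ W, lieB X₁ X₂ x = 0)

/-- Assertion (iii) of Theorem 2 (3): there are local coordinates `(x,y,z)` around `p`
with `ξ = ∂_y + ∂_z` in which the metric takes the form
`dx² + sin²θ(x) dy² + cos²θ(x) dz²`. -/
def AssertionIII (U : Set (Pt 3)) (g : Met 3) (ξ : Pt 3 → Pt 3) (p : Pt 3) : Prop :=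
  ∃ (θ : ℝ → ℝ) (W : Set (Pt 3)) (Φ Ψ : Pt 3 → Pt 3),
    ContDiff ℝ (⊤ : ℕ∞) θ ∧ IsOpen W ∧
    ContDiffOn ℝ (⊤ : ℕ∞) Φ W ∧ MapsTo Φ W U ∧
    IsOpen (Φ '' W) ∧ p ∈ Φ '' W ∧
    ContDiffOn ℝ (⊤ : ℕ∞) Ψ (Φ '' W) ∧ (∀ w ∈ W, Ψ (Φ w) = w) ∧
    (∀ w ∈ W, ∀ i j : Fin 3, pullMet g Φ w i j = tgMet θ w i j) ∧
    (∀ w ∈ W, fderiv ℝ Φ w (stdb 3 1 + stdb 3 2) = ξ (Φ w))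

section PathSpace

open scoped ContDiff Topology unitInterval

theorem ContDiffOn.exists_openPartialHomeomorph {E F : Type*} [NormedAddCommGroup E]
    [NormedSpace ℝ E] [CompleteSpace E] [NormedAddCommGroup F] [NormedSpace ℝ F]
    {f : E → F} {O : Set E} (hf : ContDiffOn ℝ (⊤ : ℕ∞) f O) (hO : IsOpen O) {a : E} (ha : a ∈ O)
    (f' : E ≃L[ℝ] F) (hf' : HasFDerivAt f (f' : E →L[ℝ] F) a) :
    ∃ e : OpenPartialHomeomorph E F, a ∈ e.source ∧ e.source ⊆ O ∧ (e : E → F) = f ∧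
      ContDiffOn ℝ (⊤ : ℕ∞) e.symm e.target := by
  have hfa : ContDiffAt ℝ (⊤ : ℕ∞) f a := hf.contDiffAt (hO.mem_nhds ha)
  have hcont : ContinuousOn (fderiv ℝ f) O := hf.continuousOn_fderiv_of_isOpen hO (by simp)
  set e₀ := hfa.toOpenPartialHomeomorph f hf' (by simp) with he₀
  set Q : Set E := O ∩ fderiv ℝ f ⁻¹' range ((↑) : (E ≃L[ℝ] F) → E →L[ℝ] F) with hQ
  have hQo : IsOpen Q := hcont.isOpen_inter_preimage hO ContinuousLinearEquiv.isOpen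
  refine ⟨e₀.restrOpen Q hQo, ?_, ?_, ?_, ?_⟩
  · exact ⟨hfa.mem_toOpenPartialHomeomorph_source hf' (by simp), ha, f', hf'.fderiv.symm⟩
  · exact fun x hx => hx.2.1
  · exact hfa.toOpenPartialHomeomorph_coe hf' (by simp)
  · intro y hy
    have hs := (e₀.restrOpen Q hQo).map_target hy
    obtain ⟨-, h1, g', hg'⟩ := hs
    have hd : HasFDerivAt f (g' : E →L[ℝ] F) ((e₀.restrOpen Q hQo).symm y) := by
      rw [hg']
      exact ((hf.contDiffAt (hO.mem_nhds h1)).differentiableAt (by simp)).hasFDerivAt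
    exact ((e₀.restrOpen Q hQo).contDiffAt_symm hy hd
      (hf.contDiffAt (hO.mem_nhds h1))).contDiffWithinAt

theorem ContDiffOn.exists_contDiff_hasCompactSupport_eventuallyEq {E F : Type*}
    [NormedAddCommGroup E] [NormedSpace ℝ E] [FiniteDimensional ℝ E]
    [NormedAddCommGroup F] [NormedSpace ℝ F]
    {f : E → F} {O : Set E} (hf : ContDiffOn ℝ (⊤ : ℕ∞) f O) (hO : IsOpen O) {a : E} (ha : a ∈ O) :
    ∃ f₁ : E → F, ContDiff ℝ (⊤ : ℕ∞) f₁ ∧ HasCompactSupport f₁ ∧ f₁ =ᶠ[𝓝 a] f := by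
  obtain ⟨r, hr, hrO⟩ := Metric.isOpen_iff.1 hO a ha
  let χ : ContDiffBump a := ⟨r / 4, r / 2, by positivity, by linarith⟩
  refine ⟨fun x => χ x • f x, ?_, ?_, ?_⟩
  · rw [contDiff_iff_contDiffAt]
    intro x
    by_cases hx : x ∈ O
    · exact (χ.contDiff.contDiffAt).smul (hf.contDiffAt (hO.mem_nhds hx))
    · have hx' : x ∉ tsupport χ := by
        rw [χ.tsupport_eq]
        intro h
        exact hx (hrO (Metric.closedBall_subset_ball (by change r / 2 < r; linarith) h))
      have h0 : (fun x => χ x • f x) =ᶠ[𝓝 x] fun _ => 0 := by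
        filter_upwards [notMem_tsupport_iff_eventuallyEq.1 hx'] with y hy
        simp [hy]
      exact contDiffAt_const.congr_of_eventuallyEq h0
  · exact χ.hasCompactSupport.smul_right
  · filter_upwards [χ.eventuallyEq_one] with x hx
    simp [hx]

variable {K : Type*} [TopologicalSpace K] [CompactSpace K]

/-- Pointwise evaluation of a continuous family of operators on a continuous function. -/
def pointwiseApply (K : Type*) [TopologicalSpace K] [CompactSpace K]
    (E F : Type*) [NormedAddCommGroup E] [NormedSpace ℝ E]
    [NormedAddCommGroup F] [NormedSpace ℝ F] :
    C(K, E →L[ℝ] F) →L[ℝ] C(K, E) →L[ℝ] C(K, F) :=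
  LinearMap.mkContinuous₂
    (LinearMap.mk₂ ℝ (fun (A : C(K, E →L[ℝ] F)) (h : C(K, E)) =>
        (⟨fun s => A s (h s), by fun_prop⟩ : C(K, F)))
      (fun _ _ _ => by ext; simp) (fun _ _ _ => by ext; simp)
      (fun _ _ _ => by ext; simp) (fun _ _ _ => by ext; simp)) 1
    (fun A h => by
      rw [one_mul]
      refine (ContinuousMap.norm_le _ (by positivity)).2 fun s => ?_
      exact (A s).le_of_opNorm_le_of_le (A.norm_coe_le_norm s) (h.norm_coe_le_norm s))

theorem ContDiff.hasFDerivAt_comp_continuousMap {E F : Type*} [NormedAddCommGroup E]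
    [NormedSpace ℝ E] [NormedAddCommGroup F] [NormedSpace ℝ F] {f : E → F}
    (hf : ContDiff ℝ (⊤ : ℕ∞) f) (hc : HasCompactSupport f) (γ : C(K, E)) :
    HasFDerivAt (fun η : C(K, E) => (⟨f, hf.continuous⟩ : C(E, F)).comp η)
      (pointwiseApply K E F
        ((⟨fderiv ℝ f, hf.continuous_fderiv (by simp)⟩ : C(E, E →L[ℝ] F)).comp γ)) γ := by
  have hf1 : ContDiff ℝ 1 (fderiv ℝ f) := hf.fderiv_right (by norm_cast)
  obtain ⟨L, hL⟩ : ∃ L, LipschitzWith L (fderiv ℝ f) :=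
    hf1.lipschitzWith_of_hasCompactSupport (hc.fderiv ℝ) (by simp)
  have key : ∀ a b : E, ‖f b - f a - fderiv ℝ f a (b - a)‖ ≤ L * ‖b - a‖ ^ 2 := by
    intro a b
    have := (convex_closedBall a ‖b - a‖).norm_image_sub_le_of_norm_hasFDerivWithin_le'
      (f := f) (f' := fderiv ℝ f) (φ := fderiv ℝ f a) (C := L * ‖b - a‖) (x := a) (y := b)
      (fun x _ => ((hf.differentiable (by simp)) x).hasFDerivAt.hasFDerivWithinAt)
      (fun x hx => by
        have h1 := hL.dist_le_mul x a
        rw [dist_eq_norm, dist_eq_norm] at h1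
        rw [Metric.mem_closedBall, dist_eq_norm] at hx
        exact h1.trans (by gcongr))
      (by simp) (by simp [dist_eq_norm])
    calc _ ≤ _ := this
      _ = _ := by ring
  set D := pointwiseApply K E F
        ((⟨fderiv ℝ f, hf.continuous_fderiv (by simp)⟩ : C(E, E →L[ℝ] F)).comp γ)
  have h0 : HasFDerivAt (fun η : C(K, E) => (⟨f, hf.continuous⟩ : C(E, F)).comp η
      - (⟨f, hf.continuous⟩ : C(E, F)).comp γ - D (η - γ)) (0 : C(K, E) →L[ℝ] C(K, F)) γ := by
    refine Asymptotics.IsBigO.hasFDerivAt (n := 2) ?_ (by norm_num)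
    refine Asymptotics.IsBigO.of_bound L (Filter.Eventually.of_forall fun η => ?_)
    rw [norm_pow, norm_norm]
    refine (ContinuousMap.norm_le _ (by positivity)).2 fun s => ?_
    calc _ ≤ L * ‖η s - γ s‖ ^ 2 := key _ _
      _ ≤ L * ‖η - γ‖ ^ 2 := by
        gcongr
        exact (η - γ).norm_coe_le_norm s
  have h1 : HasFDerivAt (fun η : C(K, E) => (⟨f, hf.continuous⟩ : C(E, F)).comp γ
      + D (η - γ)) D γ :=
    (D.hasFDerivAt.comp γ ((hasFDerivAt_id γ).sub_const γ)).const_add _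
  have := h0.add h1
  rw [zero_add] at this
  refine this.congr_of_eventuallyEq (Filter.Eventually.of_forall fun η => ?_)
  simp

universe u

theorem ContDiff.contDiff_nat_comp_continuousMap {E : Type u} [NormedAddCommGroup E]
    [NormedSpace ℝ E] (n : ℕ) : ∀ {F : Type u} [NormedAddCommGroup F] [NormedSpace ℝ F] {f : E → F}
    (hf : ContDiff ℝ (⊤ : ℕ∞) f), HasCompactSupport f →
    ContDiff ℝ n (fun η : C(K, E) => (⟨f, hf.continuous⟩ : C(E, F)).comp η) := by
  induction n with
  | zero =>
    intro F _ _ f hf _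
    exact contDiff_zero.2 (ContinuousMap.continuous_postcomp _)
  | succ n ih =>
    intro F _ _ f hf hc
    refine contDiff_succ_iff_hasFDerivAt.2 ⟨_, ?_, hf.hasFDerivAt_comp_continuousMap hc⟩
    exact (pointwiseApply K E F).contDiff.comp
      (ih (hf.fderiv_right (m := (⊤ : ℕ∞)) (by simp)) (hc.fderiv ℝ))

theorem ContDiff.contDiff_comp_continuousMap {E F : Type u} [NormedAddCommGroup E]
    [NormedSpace ℝ E] [NormedAddCommGroup F] [NormedSpace ℝ F] {f : E → F}
    (hf : ContDiff ℝ (⊤ : ℕ∞) f) (hc : HasCompactSupport f) :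
    ContDiff ℝ (⊤ : ℕ∞) (fun η : C(K, E) => (⟨f, hf.continuous⟩ : C(E, F)).comp η) :=
  contDiff_infty.2 fun n => hf.contDiff_nat_comp_continuousMap n hc

end PathSpace

section Picard

open scoped ContDiff Topology unitInterval
universe u

variable {E : Type u} [NormedAddCommGroup E] [NormedSpace ℝ E] [CompleteSpace E]

/-- The primitive `s ↦ ∫₀ˢ γ` of a continuous path, as a continuous linear operator. -/
def pathPrimitive (E : Type*) [NormedAddCommGroup E] [NormedSpace ℝ E] [CompleteSpace E] :
    C(I, E) →L[ℝ] C(I, E) :=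
  LinearMap.mkContinuous
    { toFun := fun γ => ⟨fun s => ∫ r in (0 : ℝ)..s, γ (projIcc 0 1 zero_le_one r),
        (intervalIntegral.continuous_primitive (fun a b =>
          (γ.continuous.comp continuous_projIcc).intervalIntegrable a b) 0).comp
            continuous_subtype_val⟩
      map_add' := fun γ η => by
        ext s
        exact intervalIntegral.integral_add
          ((γ.continuous.comp continuous_projIcc).intervalIntegrable _ _)
          ((η.continuous.comp continuous_projIcc).intervalIntegrable _ _)
      map_smul' := fun c γ => by
        ext s
        exact intervalIntegral.integral_smul c _ } 1
    (fun γ => by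
      rw [one_mul]
      refine (ContinuousMap.norm_le _ (by positivity)).2 fun s => ?_
      refine (intervalIntegral.norm_integral_le_of_norm_le_const (C := ‖γ‖)
        fun r _ => γ.norm_coe_le_norm _).trans ?_
      have h0 : (0 : ℝ) ≤ s := s.2.1
      have h1 : (s : ℝ) ≤ 1 := s.2.2
      rw [sub_zero, abs_of_nonneg h0]
      exact mul_le_of_le_one_right (norm_nonneg _) h1)

theorem pathPrimitive_apply (γ : C(I, E)) (s : I) :
    pathPrimitive E γ s = ∫ r in (0 : ℝ)..s, γ (projIcc 0 1 zero_le_one r) := rfl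

theorem norm_pathPrimitive_le (γ : C(I, E)) : ‖pathPrimitive E γ‖ ≤ ‖γ‖ := by
  simpa using LinearMap.mkContinuous_norm_le _ zero_le_one _ |>.trans_eq rfl |> fun h =>
    (pathPrimitive E).le_of_opNorm_le h γ

/-- `γ` is the path `s ↦ φ (t s)` where `φ` is the integral curve of `f` issuing from `x`. -/
def IsPicardFixed {f : E → E} (hf : Continuous f) (x : E) (t : ℝ) (γ : C(I, E)) : Prop :=
  γ = ContinuousMap.const I x + t • pathPrimitive E ((⟨f, hf⟩ : C(E, E)).comp γ)

theorem IsPicardFixed.eq {f : E → E} {hf : Continuous f} {L : NNReal} (hL : LipschitzWith L f)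
    {x : E} {t : ℝ} (ht : |t| * L < 1) {γ η : C(I, E)}
    (hγ : IsPicardFixed hf x t γ) (hη : IsPicardFixed hf x t η) : γ = η := by
  have h1 : ‖(⟨f, hf⟩ : C(E, E)).comp γ - (⟨f, hf⟩ : C(E, E)).comp η‖ ≤ L * ‖γ - η‖ := by
    refine (ContinuousMap.norm_le _ (by positivity)).2 fun s => ?_
    have := hL.dist_le_mul (γ s) (η s)
    rw [dist_eq_norm, dist_eq_norm] at this
    refine this.trans ?_
    gcongr
    exact (γ - η).norm_coe_le_norm s
  have h2 : γ - η = t • pathPrimitive E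
      ((⟨f, hf⟩ : C(E, E)).comp γ - (⟨f, hf⟩ : C(E, E)).comp η) := by
    rw [map_sub, smul_sub]
    conv_lhs => rw [hγ, hη]
    abel
  have h3 : ‖γ - η‖ ≤ |t| * L * ‖γ - η‖ := by
    conv_lhs => rw [h2, norm_smul, Real.norm_eq_abs]
    rw [mul_assoc]
    gcongr
    exact (norm_pathPrimitive_le _).trans h1
  have h4 : ‖γ - η‖ = 0 := by nlinarith [norm_nonneg (γ - η)]
  exact sub_eq_zero.1 (norm_eq_zero.1 h4)

theorem IsPicardFixed.rescale {f : E → E} {hf : Continuous f} {x : E} {t : ℝ} {γ : C(I, E)}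
    (hγ : IsPicardFixed hf x t γ) (s : I) :
    IsPicardFixed hf x (s * t) (γ.comp ⟨fun r => s * r, by fun_prop⟩) := by
  unfold IsPicardFixed
  ext r
  have h1 := DFunLike.congr_fun hγ (s * r)
  simp only [ContinuousMap.add_apply, ContinuousMap.const_apply, ContinuousMap.smul_apply,
    pathPrimitive_apply, ContinuousMap.comp_apply, ContinuousMap.coe_mk] at h1 ⊢
  rw [h1, mul_comm (s : ℝ) t, mul_smul]
  congr 2
  have hs0 : (0 : ℝ) ≤ s := s.2.1
  have hs1 : (s : ℝ) ≤ 1 := s.2.2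
  have h2 := intervalIntegral.smul_integral_comp_mul_left (a := 0) (b := (r : ℝ))
    (fun q => f (γ (projIcc 0 1 zero_le_one q))) (s : ℝ)
  rw [mul_zero] at h2
  rw [Icc.coe_mul, ← h2]
  congr 1
  refine intervalIntegral.integral_congr fun q hq => ?_
  rw [uIcc_of_le r.2.1] at hq
  have hq' : q ∈ Icc (0 : ℝ) 1 := ⟨hq.1, hq.2.trans r.2.2⟩
  have hm : (s : ℝ) * q ∈ Icc (0 : ℝ) 1 := (s * ⟨q, hq'⟩ : I).2
  rw [projIcc_of_mem zero_le_one hq', projIcc_of_mem zero_le_one hm]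
  rfl

end Picard

section LocalFlow

open scoped ContDiff Topology unitInterval
universe u

theorem exists_contDiffOn_isPicardFixed {E : Type u} [NormedAddCommGroup E] [NormedSpace ℝ E]
    [CompleteSpace E] {f : E → E} (hf : ContDiff ℝ (⊤ : ℕ∞) f) (hc : HasCompactSupport f) (p : E) :
    ∃ (O : Set (E × ℝ)) (Γ : E × ℝ → C(I, E)), IsOpen O ∧ (p, (0 : ℝ)) ∈ O ∧
      ContDiffOn ℝ (⊤ : ℕ∞) Γ O ∧ ∀ q ∈ O, IsPicardFixed hf.continuous q.1 q.2 (Γ q) := by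
  set N : C(I, E) → C(I, E) := fun γ => (⟨f, hf.continuous⟩ : C(E, E)).comp γ with hN
  have hNs : ContDiff ℝ (⊤ : ℕ∞) N := hf.contDiff_comp_continuousMap hc
  set cst : E →L[ℝ] C(I, E) := ContinuousLinearMap.const ℝ I with hcst
  have hcst_apply : ∀ x, cst x = ContinuousMap.const I x := fun x => rfl
  set J := pathPrimitive E
  let G : E × ℝ × C(I, E) → E × ℝ × C(I, E) :=
    fun q => (q.1, q.2.1, q.2.2 - cst q.1 - q.2.1 • J (N q.2.2))
  have hG : ContDiff ℝ (⊤ : ℕ∞) G := by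
    have h1 : ContDiff ℝ (⊤ : ℕ∞) (fun q : E × ℝ × C(I, E) => J (N q.2.2)) :=
      J.contDiff.comp (hNs.comp (contDiff_snd.comp contDiff_snd))
    have h2 : ContDiff ℝ (⊤ : ℕ∞) (fun q : E × ℝ × C(I, E) => cst q.1) :=
      cst.contDiff.comp contDiff_fst
    have h3 : ContDiff ℝ (⊤ : ℕ∞) (fun q : E × ℝ × C(I, E) => q.2.1) :=
      contDiff_fst.comp contDiff_snd
    exact contDiff_fst.prodMk (h3.prodMk
      (((contDiff_snd.comp contDiff_snd).sub h2).sub (h3.smul h1)))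
  let c : C(I, E) := J (N (cst p))
  let P1 : E × ℝ × C(I, E) →L[ℝ] E := .fst ℝ _ _
  let P2 : E × ℝ × C(I, E) →L[ℝ] ℝ := (ContinuousLinearMap.fst ℝ _ _).comp (.snd ℝ _ _)
  let P3 : E × ℝ × C(I, E) →L[ℝ] C(I, E) := (ContinuousLinearMap.snd ℝ _ _).comp (.snd ℝ _ _)
  let A : E × ℝ × C(I, E) →L[ℝ] E × ℝ × C(I, E) :=
    P1.prod (P2.prod (P3 - cst.comp P1 - P2.smulRight c))
  let A' : E × ℝ × C(I, E) →L[ℝ] E × ℝ × C(I, E) :=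
    P1.prod (P2.prod (P3 + cst.comp P1 + P2.smulRight c))
  let e' : (E × ℝ × C(I, E)) ≃L[ℝ] (E × ℝ × C(I, E)) := .equivOfInverse A A'
    (fun q => by
      simp only [A, A', P1, P2, P3, ContinuousLinearMap.prod_apply]
      refine Prod.ext rfl (Prod.ext rfl ?_)
      simp only [add_apply, sub_apply]
      dsimp
      abel)
    (fun q => by
      simp only [A, A', P1, P2, P3, ContinuousLinearMap.prod_apply]
      refine Prod.ext rfl (Prod.ext rfl ?_)
      simp only [add_apply, sub_apply]
      dsimp
      abel)
  have hGd : HasFDerivAt G (e' : E × ℝ × C(I, E) →L[ℝ] E × ℝ × C(I, E)) (p, (0 : ℝ), cst p) := by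
    have h1 : HasFDerivAt (fun q : E × ℝ × C(I, E) => J (N q.2.2))
        (fderiv ℝ (fun q : E × ℝ × C(I, E) => J (N q.2.2)) (p, (0 : ℝ), cst p)) (p, 0, cst p) :=
      ((J.contDiff.comp (hNs.comp (contDiff_snd.comp contDiff_snd))).differentiable
        (by simp) _).hasFDerivAt
    have h3 := (P2.hasFDerivAt (x := (p, (0 : ℝ), cst p))).smul h1
    have h4 := (P1.hasFDerivAt (x := (p, (0 : ℝ), cst p))).prodMk
      ((P2.hasFDerivAt (x := (p, (0 : ℝ), cst p))).prodMk
      (((P3.hasFDerivAt (x := (p, (0 : ℝ), cst p))).sub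
        ((cst.comp P1).hasFDerivAt (x := (p, (0 : ℝ), cst p)))).sub h3))
    refine h4.congr_fderiv ?_
    ext q <;> simp [e', A, P1, P2, P3, c]
  obtain ⟨e, he1, -, he3, he4⟩ :=
    (hG.contDiffOn (s := univ)).exists_openPartialHomeomorph isOpen_univ (mem_univ _) e' hGd
  have hemb : ContDiff ℝ (⊤ : ℕ∞) (fun q : E × ℝ => ((q.1, q.2, 0) : E × ℝ × C(I, E))) :=
    contDiff_fst.prodMk (contDiff_snd.prodMk contDiff_const)
  refine ⟨(fun q : E × ℝ => ((q.1, q.2, 0) : E × ℝ × C(I, E))) ⁻¹' e.target,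
    fun q => (e.symm (q.1, q.2, 0)).2.2, e.open_target.preimage hemb.continuous, ?_, ?_, ?_⟩
  · have := e.map_source he1
    rw [he3] at this
    simpa [G] using this
  · exact (contDiff_snd.comp contDiff_snd).comp_contDiffOn
      (he4.comp hemb.contDiffOn fun q hq => hq)
  · intro q hq
    have h1 := e.right_inv hq
    rw [he3] at h1
    simp only [G, Prod.mk.injEq] at h1
    obtain ⟨h1, h2, h3⟩ := h1
    rw [h1, h2] at h3
    unfold IsPicardFixed
    rw [← hcst_apply]
    have h4 := sub_eq_zero.1 h3
    rw [← h4]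
    abel

/-- Local flow of a smooth compactly supported vector field, smooth jointly in the
initial point and in time. -/
theorem exists_contDiffOn_flow {E : Type u} [NormedAddCommGroup E] [NormedSpace ℝ E]
    [CompleteSpace E] {f : E → E} (hf : ContDiff ℝ (⊤ : ℕ∞) f) (hc : HasCompactSupport f) (p : E) :
    ∃ (O : Set (E × ℝ)) (φ : E × ℝ → E), IsOpen O ∧ (p, (0 : ℝ)) ∈ O ∧
      ContDiffOn ℝ (⊤ : ℕ∞) φ O ∧ (∀ q ∈ O, q.2 = 0 → φ q = q.1) ∧
      ∀ q ∈ O, HasDerivAt (fun t => φ (q.1, t)) (f (φ q)) q.2 := by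
  obtain ⟨O, Γ, hO, hpO, hΓ, hfix⟩ := exists_contDiffOn_isPicardFixed hf hc p
  obtain ⟨L, hL⟩ : ∃ L, LipschitzWith L f := hf.lipschitzWith_of_hasCompactSupport hc (by simp)
  obtain ⟨r, hr, hrO⟩ := Metric.isOpen_iff.1 hO _ hpO
  set ρ : ℝ := min r (1 / (L + 1))
  have hρ : 0 < ρ := lt_min hr (by positivity)
  have hball : ∀ q : E × ℝ, q ∈ Metric.ball (p, (0 : ℝ)) ρ ↔ dist q.1 p < ρ ∧ |q.2| < ρ := by
    intro q
    rw [Metric.mem_ball, Prod.dist_eq, max_lt_iff, Real.dist_0_eq_abs]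
  have hsub : Metric.ball (p, (0 : ℝ)) ρ ⊆ O :=
    (Metric.ball_subset_ball (min_le_left _ _)).trans hrO
  set φ : E × ℝ → E := fun q => Γ q 1 with hφ
  have hφs : ContDiffOn ℝ (⊤ : ℕ∞) φ (Metric.ball (p, (0 : ℝ)) ρ) :=
    (ContinuousMap.evalCLM ℝ (1 : I) : C(I, E) →L[ℝ] E).contDiff.comp_contDiffOn (hΓ.mono hsub)
  have hpath : ∀ q ∈ Metric.ball (p, (0 : ℝ)) ρ, ∀ s : I, Γ q s = φ (q.1, s * q.2) := by
    intro q hq s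
    have hs : |(s : ℝ) * q.2| ≤ |q.2| := by
      rw [abs_mul, abs_of_nonneg s.2.1]
      exact mul_le_of_le_one_left (abs_nonneg _) s.2.2
    have hq' : (q.1, (s : ℝ) * q.2) ∈ Metric.ball (p, (0 : ℝ)) ρ :=
      (hball _).2 ⟨((hball _).1 hq).1, hs.trans_lt ((hball _).1 hq).2⟩
    have hlt : |(s : ℝ) * q.2| * L < 1 := by
      have h1 : |(s : ℝ) * q.2| < 1 / (L + 1) :=
        (hs.trans_lt ((hball _).1 hq).2).trans_le (min_le_right _ _)
      have hL0 : (0 : ℝ) ≤ L := L.2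
      rw [lt_div_iff₀ (by positivity)] at h1
      nlinarith [abs_nonneg ((s : ℝ) * q.2)]
    have h2 := ((hfix q (hsub hq)).rescale s).eq hL hlt (hfix _ (hsub hq'))
    have h3 := DFunLike.congr_fun h2 1
    simpa using h3
  have hint : ∀ q ∈ Metric.ball (p, (0 : ℝ)) ρ,
      φ q = q.1 + ∫ t in (0 : ℝ)..q.2, f (φ (q.1, t)) := by
    intro q hq
    have h1 := DFunLike.congr_fun (hfix q (hsub hq)) 1
    simp only [ContinuousMap.add_apply, ContinuousMap.const_apply, ContinuousMap.smul_apply,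
      pathPrimitive_apply, ContinuousMap.comp_apply, ContinuousMap.coe_mk] at h1
    change Γ q 1 = _
    rw [h1]
    congr 1
    have h2 := intervalIntegral.smul_integral_comp_mul_right (a := 0) (b := 1)
      (fun t => f (φ (q.1, t))) q.2
    rw [zero_mul, one_mul] at h2
    rw [← h2]
    congr 1
    refine intervalIntegral.integral_congr fun t ht => ?_
    rw [Icc.coe_one, uIcc_of_le zero_le_one] at ht
    change f (Γ q _) = f (φ (q.1, t * q.2))
    rw [hpath q hq, projIcc_of_mem zero_le_one ht]
  refine ⟨Metric.ball (p, 0) ρ, φ, Metric.isOpen_ball, Metric.mem_ball_self hρ, hφs, ?_, ?_⟩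
  · intro q hq h0
    rw [hint q hq, h0]
    simp
  · intro q hq
    have hcont : ContinuousOn (fun t => f (φ (q.1, t))) (Ioo (-ρ) ρ) := by
      refine hf.continuous.comp_continuousOn (hφs.continuousOn.comp (by fun_prop) ?_)
      intro t ht
      exact (hball _).2 ⟨((hball _).1 hq).1, abs_lt.2 ht⟩
    have hq2 : q.2 ∈ Ioo (-ρ) ρ := abs_lt.1 ((hball _).1 hq).2
    have hI : uIcc 0 q.2 ⊆ Ioo (-ρ) ρ :=
      ordConnected_Ioo.uIcc_subset ⟨by linarith, hρ⟩ hq2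
    have h1 := intervalIntegral.integral_hasDerivAt_right
      (hcont.mono hI).intervalIntegrable
      (hcont.stronglyMeasurableAtFilter isOpen_Ioo _ hq2)
      (hcont.continuousAt (isOpen_Ioo.mem_nhds hq2))
    refine (h1.const_add q.1).congr_of_eventuallyEq ?_
    filter_upwards [isOpen_Ioo.mem_nhds hq2] with t ht
    exact hint (q.1, t) ((hball _).2 ⟨((hball _).1 hq).1, abs_lt.2 ht⟩)

end LocalFlow

section MetricForm

open scoped ContDiff Topology

variable {n : ℕ}

theorem hasFDerivAt_sum_toSpanSingleton {E F ι : Type*} [NormedAddCommGroup E] [NormedSpace ℝ E]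
    [NormedAddCommGroup F] [NormedSpace ℝ F] [Fintype ι] {f : ι → ι → E → ℝ}
    {f' : ι → ι → E →L[ℝ] ℝ} {x : E} (c : ι → ι → F) (hf : ∀ i j, HasFDerivAt (f i j) (f' i j) x) :
    HasFDerivAt (fun y => ∑ i, ∑ j, ContinuousLinearMap.toSpanSingleton ℝ (c i j) (f i j y))
      (∑ i, ∑ j, (ContinuousLinearMap.toSpanSingleton ℝ (c i j)).comp (f' i j)) x :=
  HasFDerivAt.fun_sum fun i _ => HasFDerivAt.fun_sum fun j _ =>
    (ContinuousLinearMap.toSpanSingleton ℝ (c i j)).hasFDerivAt.comp x (hf i j)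

/-- The bilinear form `(v, w) ↦ vᵢ wⱼ`. -/
def coordTensor (i j : Fin n) : Pt n →L[ℝ] Pt n →L[ℝ] ℝ :=
  (ContinuousLinearMap.proj i : Pt n →L[ℝ] ℝ).smulRight
    (ContinuousLinearMap.proj j : Pt n →L[ℝ] ℝ)

theorem toSpanSingleton_coordTensor_apply (i j : Fin n) (c : ℝ) (v w : Pt n) :
    ContinuousLinearMap.toSpanSingleton ℝ (coordTensor i j) c v w = c * v i * w j := by
  rw [ContinuousLinearMap.toSpanSingleton_apply]
  change c * (v i * w j) = _
  ring

/-- The metric as a field of continuous bilinear forms. -/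
def metricForm (g : Met n) (x : Pt n) : Pt n →L[ℝ] Pt n →L[ℝ] ℝ :=
  ∑ i, ∑ j, ContinuousLinearMap.toSpanSingleton ℝ (coordTensor i j) (g x i j)

theorem metricForm_apply (g : Met n) (x v w : Pt n) : metricForm g x v w = minner g x v w := by
  simp only [metricForm, minner, sum_apply, toSpanSingleton_coordTensor_apply]

theorem sum_smul_stdb (v : Pt n) : ∑ i, v i • stdb n i = v := by
  ext k
  simp [stdb, Pi.single_apply]

theorem map_eq_sum_stdb {F : Type*} [NormedAddCommGroup F] [NormedSpace ℝ F] (A : Pt n →L[ℝ] F)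
    (v : Pt n) : A v = ∑ i, v i • A (stdb n i) := by
  conv_lhs => rw [← sum_smul_stdb v]
  simp

theorem metricForm_stdb (g : Met n) (x : Pt n) (i j : Fin n) :
    metricForm g x (stdb n i) (stdb n j) = g x i j := by
  simp [metricForm_apply, minner, stdb, Pi.single_apply]

theorem metricForm_congr {g h : Met n} {x y : Pt n} (hgh : ∀ i j, g x i j = h y i j) :
    metricForm g x = metricForm h y := by
  simp only [metricForm, hgh]

theorem contDiffOn_metricForm {g : Met n} {U : Set (Pt n)}
    (hg : ∀ i j, ContDiffOn ℝ (⊤ : ℕ∞) (fun x => g x i j) U) :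
    ContDiffOn ℝ (⊤ : ℕ∞) (metricForm g) U :=
  ContDiffOn.sum fun i _ => ContDiffOn.sum fun j _ =>
    (ContinuousLinearMap.contDiff _).comp_contDiffOn (hg i j)

theorem fderiv_apply_coord {m : ℕ} {Y : Pt m → Pt n} {x : Pt m} (hY : DifferentiableAt ℝ Y x)
    (k : Fin n) (v : Pt m) : fderiv ℝ (fun y => Y y k) x v = fderiv ℝ Y x v k := by
  rw [fderiv_apply hY]
  rfl

theorem fderiv_metricForm_apply {g : Met n} {x : Pt n}
    (hg : ∀ i j, DifferentiableAt ℝ (fun x => g x i j) x) (u v w : Pt n) :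
    fderiv ℝ (metricForm g) x u v w
      = ∑ i, ∑ j, ∑ k, u i * v j * w k * fderiv ℝ (fun y => g y j k) x (stdb n i) := by
  have h1 : HasFDerivAt (metricForm g) (∑ i, ∑ j,
      (ContinuousLinearMap.toSpanSingleton ℝ (coordTensor i j)).comp
        (fderiv ℝ (fun y => g y i j) x)) x :=
    hasFDerivAt_sum_toSpanSingleton (F := Pt n →L[ℝ] Pt n →L[ℝ] ℝ) coordTensor
      fun i j => (hg i j).hasFDerivAt
  rw [h1.fderiv]
  simp only [sum_apply, ContinuousLinearMap.comp_apply, toSpanSingleton_coordTensor_apply]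
  simp only [map_eq_sum_stdb _ u, smul_eq_mul, Finset.sum_mul]
  calc _ = ∑ i, ∑ k, ∑ j, u k * fderiv ℝ (fun y => g y i j) x (stdb n k) * v i * w j := by
        exact Finset.sum_congr rfl fun i _ => Finset.sum_comm
    _ = ∑ k, ∑ i, ∑ j, u k * fderiv ℝ (fun y => g y i j) x (stdb n k) * v i * w j :=
        Finset.sum_comm
    _ = _ := ?_
  refine Finset.sum_congr rfl fun i _ => Finset.sum_congr rfl fun j _ =>
    Finset.sum_congr rfl fun k _ => ?_
  ring

/-- The Christoffel symbols as a field of bilinear maps. -/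
def christoffelVec (g : Met n) (x v w : Pt n) : Pt n :=
  fun k => ∑ i, ∑ j, christoffel g x k i j * v i * w j

variable {U : Set (Pt n)} {g : Met n}

theorem IsMetricOn.metricForm_comm (hg : IsMetricOn U g) (x v w : Pt n) :
    metricForm g x v w = metricForm g x w v := by
  simp only [metricForm_apply, minner]
  rw [Finset.sum_comm]
  refine Finset.sum_congr rfl fun i _ => Finset.sum_congr rfl fun j _ => ?_
  rw [hg.2.1 x j i]
  ring

theorem IsMetricOn.metricForm_self_pos (hg : IsMetricOn U g) {x : Pt n} (hx : x ∈ U) {v : Pt n}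
    (hv : v ≠ 0) : 0 < metricForm g x v v := by
  rw [metricForm_apply]
  exact hg.2.2 x hx v hv

theorem IsMetricOn.eq_zero_of_metricForm (hg : IsMetricOn U g) {x : Pt n} (hx : x ∈ U) {v : Pt n}
    (hv : ∀ z, metricForm g x v z = 0) : v = 0 := by
  by_contra h
  exact (hg.metricForm_self_pos hx h).ne' (hv v)

theorem IsMetricOn.differentiableAt (hg : IsMetricOn U g) (hU : IsOpen U) {x : Pt n} (hx : x ∈ U)
    (i j : Fin n) : DifferentiableAt ℝ (fun x => g x i j) x :=
  ((hg.1 i j).contDiffAt (hU.mem_nhds hx)).differentiableAt (by simp)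

theorem IsMetricOn.differentiableAt_metricForm (hg : IsMetricOn U g) (hU : IsOpen U) {x : Pt n}
    (hx : x ∈ U) : DifferentiableAt ℝ (metricForm g) x :=
  ((contDiffOn_metricForm hg.1).contDiffAt (hU.mem_nhds hx)).differentiableAt (by simp)

theorem IsMetricOn.isUnit_det (hg : IsMetricOn U g) {x : Pt n} (hx : x ∈ U) :
    IsUnit (Matrix.of (g x)).det := by
  rw [isUnit_iff_ne_zero]
  intro h
  obtain ⟨v, hv, hv0⟩ := Matrix.exists_mulVec_eq_zero_iff.2 h
  refine hv (hg.eq_zero_of_metricForm hx fun z => ?_)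
  rw [hg.metricForm_comm, metricForm_apply, minner]
  refine Finset.sum_eq_zero fun i _ => ?_
  have := congrFun hv0 i
  simp only [Matrix.mulVec, dotProduct, Matrix.of_apply, Pi.zero_apply] at this
  calc _ = z i * ∑ j, g x i j * v j := by
        rw [Finset.mul_sum]
        exact Finset.sum_congr rfl fun j _ => by ring
    _ = 0 := by rw [this, mul_zero]

theorem IsMetricOn.sum_mul_christoffel (hg : IsMetricOn U g) {x : Pt n} (hx : x ∈ U)
    (i j m : Fin n) :
    ∑ k, g x k m * christoffel g x k i j = (1 / 2) * (fderiv ℝ (fun y => g y j m) x (stdb n i)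
      + fderiv ℝ (fun y => g y i m) x (stdb n j) - fderiv ℝ (fun y => g y i j) x (stdb n m)) := by
  set c : Fin n → ℝ := fun l => fderiv ℝ (fun y => g y j l) x (stdb n i)
      + fderiv ℝ (fun y => g y i l) x (stdb n j) - fderiv ℝ (fun y => g y i j) x (stdb n l)
  have h1 : ∀ l, ∑ k, g x m k * ginv g x k l = if m = l then 1 else 0 := by
    intro l
    have := congrFun (congrFun (Matrix.mul_nonsing_inv (Matrix.of (g x)) (hg.isUnit_det hx)) m) l
    rwa [Matrix.mul_apply, Matrix.one_apply] at this
  calc _ = ∑ k, ∑ l, (1 / 2) * (g x m k * ginv g x k l * c l) := by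
        refine Finset.sum_congr rfl fun k _ => ?_
        rw [christoffel, Finset.mul_sum, Finset.mul_sum]
        refine Finset.sum_congr rfl fun l _ => ?_
        rw [hg.2.1 x k m]
        ring
    _ = ∑ l, (1 / 2) * ((∑ k, g x m k * ginv g x k l) * c l) := by
        rw [Finset.sum_comm]
        refine Finset.sum_congr rfl fun l _ => ?_
        rw [Finset.sum_mul, Finset.mul_sum]
    _ = _ := by simp [h1, c]

/-- The Koszul formula in a chart. -/
theorem IsMetricOn.two_mul_metricForm_christoffelVec (hg : IsMetricOn U g) (hU : IsOpen U)
    {x : Pt n} (hx : x ∈ U) (v w z : Pt n) :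
    2 * metricForm g x (christoffelVec g x v w) z
      = fderiv ℝ (metricForm g) x v w z + fderiv ℝ (metricForm g) x w v z
        - fderiv ℝ (metricForm g) x z v w := by
  have hd := hg.differentiableAt hU hx
  rw [fderiv_metricForm_apply hd, fderiv_metricForm_apply hd, fderiv_metricForm_apply hd]
  have e2 : ∀ d : Fin n → Fin n → Fin n → ℝ, ∑ i, ∑ j, ∑ k, w i * v j * z k * d i j k
      = ∑ i, ∑ j, ∑ k, v i * w j * z k * d j i k := by
    intro d
    rw [Finset.sum_comm]
    refine Finset.sum_congr rfl fun i _ => Finset.sum_congr rfl fun j _ =>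
      Finset.sum_congr rfl fun k _ => by ring
  have e3 : ∀ d : Fin n → Fin n → Fin n → ℝ, ∑ i, ∑ j, ∑ k, z i * v j * w k * d i j k
      = ∑ i, ∑ j, ∑ k, v i * w j * z k * d k i j := by
    intro d
    rw [Finset.sum_comm]
    refine Finset.sum_congr rfl fun i _ => ?_
    rw [Finset.sum_comm]
    refine Finset.sum_congr rfl fun j _ => Finset.sum_congr rfl fun k _ => by ring
  rw [e2 fun i j k => fderiv ℝ (fun y => g y j k) x (stdb n i),
    e3 fun i j k => fderiv ℝ (fun y => g y j k) x (stdb n i)]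
  have e1 : metricForm g x (christoffelVec g x v w) z
      = ∑ i, ∑ j, ∑ m, v i * w j * z m * ∑ k, g x k m * christoffel g x k i j := by
    simp only [metricForm_apply, minner, christoffelVec, Finset.mul_sum, Finset.sum_mul]
    rw [Finset.sum_comm]
    calc _ = ∑ m, ∑ i, ∑ j, ∑ k, v i * w j * z m * (g x k m * christoffel g x k i j) := by
          refine Finset.sum_congr rfl fun m _ => ?_
          rw [Finset.sum_comm]
          refine Finset.sum_congr rfl fun i _ => ?_
          rw [Finset.sum_comm]
          refine Finset.sum_congr rfl fun j _ => Finset.sum_congr rfl fun k _ => by ring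
      _ = _ := by
          rw [Finset.sum_comm]
          refine Finset.sum_congr rfl fun i _ => ?_
          rw [Finset.sum_comm]
  simp only [e1, hg.sum_mul_christoffel hx, Finset.mul_sum, ← Finset.sum_add_distrib,
    ← Finset.sum_sub_distrib]
  refine Finset.sum_congr rfl fun i _ => Finset.sum_congr rfl fun j _ =>
    Finset.sum_congr rfl fun k _ => by ring

theorem covD_eq {Y : Pt n → Pt n} {x : Pt n} (hY : DifferentiableAt ℝ Y x) (v : Pt n) :
    covD g Y x v = fderiv ℝ Y x v + christoffelVec g x v (Y x) := by
  ext k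
  simp only [covD, fderiv_apply_coord hY, Pi.add_apply, christoffelVec]

theorem lieB_eq {X Y : Pt n → Pt n} {x : Pt n} (hX : DifferentiableAt ℝ X x)
    (hY : DifferentiableAt ℝ Y x) :
    lieB X Y x = fderiv ℝ Y x (X x) - fderiv ℝ X x (Y x) := by
  ext k
  simp only [lieB, fderiv_apply_coord hX, fderiv_apply_coord hY, Pi.sub_apply]

theorem covAlong_eq {g : Met (n + 1)} {F W : Pt n → Pt (n + 1)} {u : Pt n}
    (hW : DifferentiableAt ℝ W u) (v : Pt n) :
    covAlong g F W u v = fderiv ℝ W u v + christoffelVec g (F u) (fderiv ℝ F u v) (W u) := by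
  ext k
  simp only [covAlong, fderiv_apply_coord hW, Pi.add_apply, christoffelVec]

/-- The Lie derivative of the metric along `X`. -/
def lieMetric (g : Met n) (X : Pt n → Pt n) (x v w : Pt n) : ℝ :=
  fderiv ℝ (metricForm g) x (X x) v w + metricForm g x (fderiv ℝ X x v) w
    + metricForm g x v (fderiv ℝ X x w)

theorem IsMetricOn.fderiv_metricForm_comm (hg : IsMetricOn U g) (hU : IsOpen U)
    {x : Pt n} (hx : x ∈ U) (u v w : Pt n) :
    fderiv ℝ (metricForm g) x u v w = fderiv ℝ (metricForm g) x u w v := by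
  have hd := hg.differentiableAt hU hx
  rw [fderiv_metricForm_apply hd, fderiv_metricForm_apply hd]
  refine Finset.sum_congr rfl fun i _ => ?_
  rw [Finset.sum_comm]
  refine Finset.sum_congr rfl fun j _ => Finset.sum_congr rfl fun k _ => ?_
  simp only [hg.2.1 _ k j]
  ring

theorem IsMetricOn.isKillingOn_iff (hg : IsMetricOn U g) (hU : IsOpen U) {W : Set (Pt n)}
    (hW : W ⊆ U) {X : Pt n → Pt n} (hX : ∀ x ∈ W, DifferentiableAt ℝ X x) :
    IsKillingOn W g X ↔ ∀ x ∈ W, ∀ v w, lieMetric g X x v w = 0 := by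
  refine forall₂_congr fun x hx => forall₂_congr fun v w => ?_
  rw [← metricForm_apply, ← metricForm_apply, covD_eq (hX x hx), covD_eq (hX x hx), lieMetric]
  have h1 := hg.two_mul_metricForm_christoffelVec hU (hW hx) v (X x) w
  have h2 := hg.two_mul_metricForm_christoffelVec hU (hW hx) w (X x) v
  rw [hg.fderiv_metricForm_comm hU (hW hx) w (X x) v] at h2
  rw [hg.fderiv_metricForm_comm hU (hW hx) v (X x) w] at h1
  have h3 := hg.fderiv_metricForm_comm hU (hW hx) (X x) v w
  have h4 := hg.fderiv_metricForm_comm hU (hW hx) v (X x) w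
  have h5 := hg.fderiv_metricForm_comm hU (hW hx) w (X x) v
  rw [hg.metricForm_comm x v]
  simp only [map_add, add_apply]
  constructor <;> intro h <;> linarith

end MetricForm

section Naturality

open scoped ContDiff Topology

theorem fderiv_bilin_apply {E F : Type*} [NormedAddCommGroup E] [NormedSpace ℝ E]
    [NormedAddCommGroup F] [NormedSpace ℝ F] {B : E → F →L[ℝ] F →L[ℝ] ℝ} {V W : E → F} {x : E}
    (hB : DifferentiableAt ℝ B x) (hV : DifferentiableAt ℝ V x) (hW : DifferentiableAt ℝ W x)
    (v : E) :
    fderiv ℝ (fun y => B y (V y) (W y)) x v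
      = fderiv ℝ B x v (V x) (W x) + B x (fderiv ℝ V x v) (W x) + B x (V x) (fderiv ℝ W x v) := by
  have h := (hB.hasFDerivAt.clm_apply hV.hasFDerivAt).clm_apply hW.hasFDerivAt
  rw [h.fderiv]
  simp
  ring

theorem fderiv_bilin_comp_apply {D E F : Type*} [NormedAddCommGroup D] [NormedSpace ℝ D]
    [NormedAddCommGroup E] [NormedSpace ℝ E] [NormedAddCommGroup F] [NormedSpace ℝ F]
    {B : E → F →L[ℝ] F →L[ℝ] ℝ} {P : D → E} {V W : D → F} {x : D}
    (hB : DifferentiableAt ℝ B (P x)) (hP : DifferentiableAt ℝ P x) (hV : DifferentiableAt ℝ V x)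
    (hW : DifferentiableAt ℝ W x) (v : D) :
    fderiv ℝ (fun y => B (P y) (V y) (W y)) x v
      = fderiv ℝ B (P x) (fderiv ℝ P x v) (V x) (W x) + B (P x) (fderiv ℝ V x v) (W x)
        + B (P x) (V x) (fderiv ℝ W x v) := by
  have h := fderiv_bilin_apply (B := fun y => B (P y))
    (DifferentiableAt.comp (G := F →L[ℝ] F →L[ℝ] ℝ) x hB hP) hV hW v
  rw [h]
  congr 3
  exact congrArg (fun A => A v (V x)) (fderiv_comp (G := F →L[ℝ] F →L[ℝ] ℝ) x hB hP)

theorem fderiv_clm_apply_apply {E F G : Type*} [NormedAddCommGroup E] [NormedSpace ℝ E]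
    [NormedAddCommGroup F] [NormedSpace ℝ F] [NormedAddCommGroup G] [NormedSpace ℝ G]
    {A : E → F →L[ℝ] G} {V : E → F} {x : E}
    (hA : DifferentiableAt ℝ A x) (hV : DifferentiableAt ℝ V x) (v : E) :
    fderiv ℝ (fun y => A y (V y)) x v = fderiv ℝ A x v (V x) + A x (fderiv ℝ V x v) := by
  rw [(hA.hasFDerivAt.clm_apply hV.hasFDerivAt).fderiv]
  simp [add_comm]

theorem ContDiffOn.fderiv_top {E F : Type*} [NormedAddCommGroup E] [NormedSpace ℝ E]
    [NormedAddCommGroup F] [NormedSpace ℝ F] {f : E → F} {s : Set E}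
    (hf : ContDiffOn ℝ (⊤ : ℕ∞) f s) (hs : IsOpen s) :
    ContDiffOn ℝ (⊤ : ℕ∞) (fderiv ℝ f) s :=
  hf.fderiv_of_isOpen hs (by simp)

theorem ContDiffOn.differentiableAt_top {E F : Type*} [NormedAddCommGroup E] [NormedSpace ℝ E]
    [NormedAddCommGroup F] [NormedSpace ℝ F] {f : E → F} {s : Set E}
    (hf : ContDiffOn ℝ (⊤ : ℕ∞) f s) (hs : IsOpen s) {x : E} (hx : x ∈ s) :
    DifferentiableAt ℝ f x :=
  (hf.contDiffAt (hs.mem_nhds hx)).differentiableAt (by simp)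

theorem ContDiffOn.fderiv_fderiv_comm {E F : Type*} [NormedAddCommGroup E] [NormedSpace ℝ E]
    [NormedAddCommGroup F] [NormedSpace ℝ F] {f : E → F} {s : Set E}
    (hf : ContDiffOn ℝ (⊤ : ℕ∞) f s) (hs : IsOpen s) {x : E} (hx : x ∈ s) (v w : E) :
    fderiv ℝ (fderiv ℝ f) x v w = fderiv ℝ (fderiv ℝ f) x w v :=
  (hf.contDiffAt (hs.mem_nhds hx)).isSymmSndFDerivAt (by
    simp [minSmoothness_of_isRCLikeNormedField]
    exact WithTop.coe_le_coe.2 le_top) v w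

variable {n : ℕ} {U W : Set (Pt n)} {g : Met n} {Φ Ψ : Pt n → Pt n}

theorem metricForm_pullMet (g : Met n) (Φ : Pt n → Pt n) (w a b : Pt n) :
    metricForm (pullMet g Φ) w a b = metricForm g (Φ w) (fderiv ℝ Φ w a) (fderiv ℝ Φ w b) := by
  rw [map_eq_sum_stdb (fderiv ℝ Φ w) a, map_eq_sum_stdb (fderiv ℝ Φ w) b,
    metricForm_apply, minner]
  simp only [pullMet, map_sum, map_smul, sum_apply, smul_apply, metricForm_apply, smul_eq_mul]
  rw [Finset.sum_comm]
  simp only [Finset.mul_sum]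
  refine Finset.sum_congr rfl fun i _ => Finset.sum_congr rfl fun j _ => ?_
  ring

theorem contDiffOn_metricForm_apply {m : ℕ} {V : Set (Pt m)} (hg : IsMetricOn U g)
    {P Y Z : Pt m → Pt n}
    (hP : ContDiffOn ℝ (⊤ : ℕ∞) P V) (hPm : MapsTo P V U) (hY : ContDiffOn ℝ (⊤ : ℕ∞) Y V)
    (hZ : ContDiffOn ℝ (⊤ : ℕ∞) Z V) :
    ContDiffOn ℝ (⊤ : ℕ∞) (fun x => metricForm g (P x) (Y x) (Z x)) V :=
  (((contDiffOn_metricForm hg.1).comp hP hPm).clm_apply hY).clm_apply hZ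

theorem IsMetricOn.pullMet (hg : IsMetricOn U g) (hW : IsOpen W)
    (hΦ : ContDiffOn ℝ (⊤ : ℕ∞) Φ W) (hm : MapsTo Φ W U)
    (hinj : ∀ w ∈ W, Function.Injective (fderiv ℝ Φ w)) : IsMetricOn W (pullMet g Φ) := by
  refine ⟨fun i j => ?_, fun x i j => ?_, fun w hw v hv => ?_⟩
  · simp only [_root_.pullMet, ← metricForm_apply]
    exact contDiffOn_metricForm_apply hg hΦ hm ((hΦ.fderiv_top hW).clm_apply contDiffOn_const)
      ((hΦ.fderiv_top hW).clm_apply contDiffOn_const)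
  · simp only [_root_.pullMet, ← metricForm_apply]
    exact hg.metricForm_comm _ _ _
  · rw [← metricForm_apply, metricForm_pullMet]
    refine hg.metricForm_self_pos (hm hw) fun h => hv (hinj w hw ?_)
    rw [h, map_zero]

/-- A parametrization of an open subset of `U`, with inverse `Ψ`. -/
structure IsChart (U W : Set (Pt n)) (Φ Ψ : Pt n → Pt n) : Prop where
  isOpen : IsOpen W
  contDiffOn : ContDiffOn ℝ (⊤ : ℕ∞) Φ W
  mapsTo : MapsTo Φ W U
  isOpen_image : IsOpen (Φ '' W)
  contDiffOn_symm : ContDiffOn ℝ (⊤ : ℕ∞) Ψ (Φ '' W)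
  left_inv : ∀ w ∈ W, Ψ (Φ w) = w

namespace IsChart

theorem mapsTo_symm (hc : IsChart U W Φ Ψ) : MapsTo Ψ (Φ '' W) W := by
  rintro _ ⟨w, hw, rfl⟩
  rwa [hc.left_inv w hw]

theorem right_inv (hc : IsChart U W Φ Ψ) {x : Pt n} (hx : x ∈ Φ '' W) : Φ (Ψ x) = x := by
  obtain ⟨w, hw, rfl⟩ := hx
  rw [hc.left_inv w hw]

theorem fderiv_symm_fderiv (hc : IsChart U W Φ Ψ) {w : Pt n} (hw : w ∈ W) (v : Pt n) :
    fderiv ℝ Ψ (Φ w) (fderiv ℝ Φ w v) = v := by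
  have h1 := (hc.contDiffOn_symm.differentiableAt_top hc.isOpen_image
    (mem_image_of_mem Φ hw)).hasFDerivAt.comp w
    (hc.contDiffOn.differentiableAt_top hc.isOpen hw).hasFDerivAt
  have h2 : HasFDerivAt (Ψ ∘ Φ) (ContinuousLinearMap.id ℝ (Pt n)) w :=
    (hasFDerivAt_id w).congr_of_eventuallyEq
      (Filter.eventuallyEq_of_mem (hc.isOpen.mem_nhds hw) hc.left_inv)
  exact congrArg (fun A : Pt n →L[ℝ] Pt n => A v) (h1.unique h2)

theorem fderiv_fderiv_symm (hc : IsChart U W Φ Ψ) {w : Pt n} (hw : w ∈ W) (v : Pt n) :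
    fderiv ℝ Φ w (fderiv ℝ Ψ (Φ w) v) = v := by
  have h1 : fderiv ℝ Ψ (Φ w) ∘L fderiv ℝ Φ w = ContinuousLinearMap.id ℝ (Pt n) := by
    ext1 v
    exact hc.fderiv_symm_fderiv hw v
  have h2 : (fderiv ℝ Ψ (Φ w) : Pt n →ₗ[ℝ] Pt n) ∘ₗ (fderiv ℝ Φ w : Pt n →ₗ[ℝ] Pt n)
      = LinearMap.id := congrArg ContinuousLinearMap.toLinearMap h1
  exact LinearMap.congr_fun ((LinearMap.comp_eq_id_comm ℝ (Pt n)).1 h2) v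

theorem injective_fderiv (hc : IsChart U W Φ Ψ) {w : Pt n} (hw : w ∈ W) :
    Function.Injective (fderiv ℝ Φ w) :=
  Function.LeftInverse.injective (hc.fderiv_symm_fderiv hw)

theorem surjective_fderiv (hc : IsChart U W Φ Ψ) {w : Pt n} (hw : w ∈ W) :
    Function.Surjective (fderiv ℝ Φ w) :=
  Function.RightInverse.surjective (hc.fderiv_fderiv_symm hw)

theorem isMetricOn (hc : IsChart U W Φ Ψ) (hg : IsMetricOn U g) : IsMetricOn W (pullMet g Φ) :=
  hg.pullMet hc.isOpen hc.contDiffOn hc.mapsTo fun _ => hc.injective_fderiv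

end IsChart

theorem fderiv_metricForm_pullMet (hg : IsMetricOn U g) (hU : IsOpen U) (hc : IsChart U W Φ Ψ)
    {w : Pt n} (hw : w ∈ W) (v a b : Pt n) :
    fderiv ℝ (metricForm (pullMet g Φ)) w v a b
      = fderiv ℝ (metricForm g) (Φ w) (fderiv ℝ Φ w v) (fderiv ℝ Φ w a) (fderiv ℝ Φ w b)
        + metricForm g (Φ w) (fderiv ℝ (fderiv ℝ Φ) w v a) (fderiv ℝ Φ w b)
        + metricForm g (Φ w) (fderiv ℝ Φ w a) (fderiv ℝ (fderiv ℝ Φ) w v b) := by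
  have hd := (hc.isMetricOn hg).differentiableAt_metricForm hc.isOpen hw
  have hdg := hg.differentiableAt_metricForm hU (hc.mapsTo hw)
  have hdΦ := hc.contDiffOn.differentiableAt_top hc.isOpen hw
  have hdD := (hc.contDiffOn.fderiv_top hc.isOpen).differentiableAt_top hc.isOpen hw
  have e1 := fderiv_bilin_apply hd (differentiableAt_const (c := a) (x := w))
    (differentiableAt_const b) v
  have e2 := fderiv_bilin_comp_apply hdg hdΦ (hdD.clm_apply (differentiableAt_const a))
    (hdD.clm_apply (differentiableAt_const b)) v
  simp only [metricForm_pullMet] at e1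
  rw [fderiv_clm_apply_apply hdD (differentiableAt_const a),
    fderiv_clm_apply_apply hdD (differentiableAt_const b), e1] at e2
  simp only [fderiv_fun_const, Pi.zero_apply, _root_.zero_apply, map_zero,
    add_zero] at e2
  rw [e2]

/-- The derivatives of vector fields `Y` and `X` related by `Φ` correspond. -/
theorem fderiv_related (hc : IsChart U W Φ Ψ) {X Y : Pt n → Pt n} {w : Pt n} (hw : w ∈ W)
    (hX : DifferentiableAt ℝ X (Φ w)) (hY : DifferentiableAt ℝ Y w)
    (hXY : ∀ᶠ y in 𝓝 w, X (Φ y) = fderiv ℝ Φ y (Y y)) (v : Pt n) :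
    fderiv ℝ X (Φ w) (fderiv ℝ Φ w v)
      = fderiv ℝ (fderiv ℝ Φ) w v (Y w) + fderiv ℝ Φ w (fderiv ℝ Y w v) := by
  have hdΦ := hc.contDiffOn.differentiableAt_top hc.isOpen hw
  have hdD := (hc.contDiffOn.fderiv_top hc.isOpen).differentiableAt_top hc.isOpen hw
  rw [← fderiv_clm_apply_apply hdD hY, ← Filter.EventuallyEq.fderiv_eq hXY]
  exact congrArg (fun A : Pt n →L[ℝ] Pt n => A v) (fderiv_comp w hX hdΦ).symm

theorem lieMetric_related (hg : IsMetricOn U g) (hU : IsOpen U) (hc : IsChart U W Φ Ψ)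
    {X Y : Pt n → Pt n} {w : Pt n} (hw : w ∈ W)
    (hX : DifferentiableAt ℝ X (Φ w)) (hY : DifferentiableAt ℝ Y w)
    (hXY : ∀ᶠ y in 𝓝 w, X (Φ y) = fderiv ℝ Φ y (Y y)) (a b : Pt n) :
    lieMetric g X (Φ w) (fderiv ℝ Φ w a) (fderiv ℝ Φ w b) = lieMetric (pullMet g Φ) Y w a b := by
  rw [lieMetric, lieMetric, fderiv_metricForm_pullMet hg hU hc hw, metricForm_pullMet,
    metricForm_pullMet, fderiv_related hc hw hX hY hXY, fderiv_related hc hw hX hY hXY,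
    hXY.self_of_nhds, hc.contDiffOn.fderiv_fderiv_comm hc.isOpen hw (Y w) a,
    hc.contDiffOn.fderiv_fderiv_comm hc.isOpen hw (Y w) b]
  simp only [map_add, add_apply]
  ring

theorem lieB_related (hc : IsChart U W Φ Ψ)
    {X Y X' Y' : Pt n → Pt n} {w : Pt n} (hw : w ∈ W)
    (hX : DifferentiableAt ℝ X (Φ w)) (hY : DifferentiableAt ℝ Y w)
    (hXY : ∀ᶠ y in 𝓝 w, X (Φ y) = fderiv ℝ Φ y (Y y))
    (hX' : DifferentiableAt ℝ X' (Φ w)) (hY' : DifferentiableAt ℝ Y' w)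
    (hXY' : ∀ᶠ y in 𝓝 w, X' (Φ y) = fderiv ℝ Φ y (Y' y)) :
    lieB X X' (Φ w) = fderiv ℝ Φ w (lieB Y Y' w) := by
  rw [lieB_eq hX hX', lieB_eq hY hY', hXY.self_of_nhds, hXY'.self_of_nhds,
    fderiv_related hc hw hX hY hXY, fderiv_related hc hw hX' hY' hXY',
    hc.contDiffOn.fderiv_fderiv_comm hc.isOpen hw (Y w) (Y' w), map_sub]
  abel

/-- The Levi-Civita connection is natural. -/
theorem christoffelVec_pullMet (hg : IsMetricOn U g) (hU : IsOpen U) (hc : IsChart U W Φ Ψ)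
    {w : Pt n} (hw : w ∈ W) (v a : Pt n) :
    fderiv ℝ (fderiv ℝ Φ) w v a + christoffelVec g (Φ w) (fderiv ℝ Φ w v) (fderiv ℝ Φ w a)
      = fderiv ℝ Φ w (christoffelVec (pullMet g Φ) w v a) := by
  rw [← sub_eq_zero]
  refine hg.eq_zero_of_metricForm (hc.mapsTo hw) fun z => ?_
  obtain ⟨z, rfl⟩ := hc.surjective_fderiv hw z
  have h1 := hg.two_mul_metricForm_christoffelVec hU (hc.mapsTo hw) (fderiv ℝ Φ w v)
    (fderiv ℝ Φ w a) (fderiv ℝ Φ w z)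
  have h2 := (hc.isMetricOn hg).two_mul_metricForm_christoffelVec hc.isOpen hw v a z
  simp only [fderiv_metricForm_pullMet hg hU hc hw, metricForm_pullMet] at h2
  have hs := hc.contDiffOn.fderiv_fderiv_comm hc.isOpen hw
  rw [hs a v, hs z v, hs z a, hg.metricForm_comm _ (fderiv ℝ Φ w v) (fderiv ℝ (fderiv ℝ Φ) w a z),
    hg.metricForm_comm _ (fderiv ℝ Φ w a) (fderiv ℝ (fderiv ℝ Φ) w v z)] at h2
  simp only [map_add, map_sub, add_apply, sub_apply]
  linarith

theorem covAlong_related {g : Met (n + 1)} {U W : Set (Pt (n + 1))} {Φ Ψ : Pt (n + 1) → Pt (n + 1)}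
    (hg : IsMetricOn U g) (hU : IsOpen U) (hc : IsChart U W Φ Ψ)
    {F N ι Y : Pt n → Pt (n + 1)} {u : Pt n} (hw : ι u ∈ W) (hι : DifferentiableAt ℝ ι u)
    (hY : DifferentiableAt ℝ Y u) (hF : ∀ᶠ y in 𝓝 u, F y = Φ (ι y))
    (hN : ∀ᶠ y in 𝓝 u, N y = fderiv ℝ Φ (ι y) (Y y)) (v : Pt n) :
    covAlong g F N u v = fderiv ℝ Φ (ι u) (covAlong (pullMet g Φ) ι Y u v) := by
  have hdΦ := hc.contDiffOn.differentiableAt_top hc.isOpen hw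
  have hdD := (hc.contDiffOn.fderiv_top hc.isOpen).differentiableAt_top hc.isOpen hw
  have hdDι : DifferentiableAt ℝ (fun y => fderiv ℝ Φ (ι y)) u := hdD.comp u hι
  have hN' : DifferentiableAt ℝ N u :=
    (hdDι.clm_apply hY).congr_of_eventuallyEq hN
  rw [covAlong_eq hN', covAlong_eq hY, map_add, ← christoffelVec_pullMet hg hU hc hw,
    Filter.EventuallyEq.fderiv_eq hN, fderiv_clm_apply_apply hdDι hY, hF.self_of_nhds,
    hN.self_of_nhds, Filter.EventuallyEq.fderiv_eq hF]
  have e1 : fderiv ℝ (fun y => fderiv ℝ Φ (ι y)) u v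
      = fderiv ℝ (fderiv ℝ Φ) (ι u) (fderiv ℝ ι u v) :=
    congrArg (fun A => A v) (fderiv_comp u hdD hι)
  have e2 : fderiv ℝ (fun y => Φ (ι y)) u v = fderiv ℝ Φ (ι u) (fderiv ℝ ι u v) :=
    congrArg (fun A : Pt n →L[ℝ] Pt (n + 1) => A v) (fderiv_comp u hdΦ hι)
  rw [e1, e2]
  abel

end Naturality

section TrigForm

open scoped ContDiff Topology

section Push

variable {n : ℕ} {U W : Set (Pt n)} {g : Met n} {Φ Ψ : Pt n → Pt n}

/-- The pushforward of the vector field `Y` under `Φ`, with inverse `Ψ`. -/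
def pushField (Φ Ψ Y : Pt n → Pt n) (x : Pt n) : Pt n := fderiv ℝ Φ (Ψ x) (Y (Ψ x))

theorem IsChart.pushField_apply (hc : IsChart U W Φ Ψ) {w : Pt n} (hw : w ∈ W) (Y : Pt n → Pt n) :
    pushField Φ Ψ Y (Φ w) = fderiv ℝ Φ w (Y w) := by
  rw [pushField, hc.left_inv w hw]

theorem IsChart.pushField_eventually (hc : IsChart U W Φ Ψ) {w : Pt n} (hw : w ∈ W)
    (Y : Pt n → Pt n) : ∀ᶠ y in 𝓝 w, pushField Φ Ψ Y (Φ y) = fderiv ℝ Φ y (Y y) := by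
  filter_upwards [hc.isOpen.mem_nhds hw] with y hy using hc.pushField_apply hy Y

theorem IsChart.contDiffOn_pushField (hc : IsChart U W Φ Ψ) {Y : Pt n → Pt n}
    (hY : ContDiffOn ℝ (⊤ : ℕ∞) Y W) : ContDiffOn ℝ (⊤ : ℕ∞) (pushField Φ Ψ Y) (Φ '' W) :=
  ((hc.contDiffOn.fderiv_top hc.isOpen).comp hc.contDiffOn_symm hc.mapsTo_symm).clm_apply
    (hY.comp hc.contDiffOn_symm hc.mapsTo_symm)

theorem IsChart.isKillingOn_pushField (hg : IsMetricOn U g) (hU : IsOpen U)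
    (hc : IsChart U W Φ Ψ) {Y : Pt n → Pt n} (hY : ContDiffOn ℝ (⊤ : ℕ∞) Y W)
    (hK : ∀ w ∈ W, ∀ a b, lieMetric (pullMet g Φ) Y w a b = 0) :
    IsKillingOn (Φ '' W) g (pushField Φ Ψ Y) := by
  have hs := hc.contDiffOn_pushField hY
  rw [hg.isKillingOn_iff hU hc.mapsTo.image_subset
    fun x hx => hs.differentiableAt_top hc.isOpen_image hx]
  rintro _ ⟨w, hw, rfl⟩ a b
  obtain ⟨a, rfl⟩ := hc.surjective_fderiv hw a
  obtain ⟨b, rfl⟩ := hc.surjective_fderiv hw b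
  rw [lieMetric_related hg hU hc hw
    (hs.differentiableAt_top hc.isOpen_image (mem_image_of_mem Φ hw))
    (hY.differentiableAt_top hc.isOpen hw) (hc.pushField_eventually hw Y), hK w hw]

end Push

variable {U W : Set (Pt 3)} {g : Met 3} {Φ Ψ ξ : Pt 3 → Pt 3} {p : Pt 3}

theorem assertionII_of_isChart (hg : IsMetricOn U g) (hU : IsOpen U) (hc : IsChart U W Φ Ψ)
    (hp : p ∈ Φ '' W) {Y₁ Y₂ : Pt 3 → Pt 3} (h₁ : ContDiffOn ℝ (⊤ : ℕ∞) Y₁ W)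
    (h₂ : ContDiffOn ℝ (⊤ : ℕ∞) Y₂ W)
    (hsum : ∀ w ∈ W, fderiv ℝ Φ w (Y₁ w + Y₂ w) = ξ (Φ w))
    (horth : ∀ w ∈ W, metricForm (pullMet g Φ) w (Y₁ w) (Y₂ w) = 0)
    (hne₁ : ∀ w ∈ W, Y₁ w ≠ 0) (hne₂ : ∀ w ∈ W, Y₂ w ≠ 0)
    (hK₁ : ∀ w ∈ W, ∀ a b, lieMetric (pullMet g Φ) Y₁ w a b = 0)
    (hK₂ : ∀ w ∈ W, ∀ a b, lieMetric (pullMet g Φ) Y₂ w a b = 0)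
    (hB : ∀ w ∈ W, lieB Y₁ Y₂ w = 0) : AssertionII U g ξ p := by
  have hne : ∀ {Y : Pt 3 → Pt 3}, (∀ w ∈ W, Y w ≠ 0) → ∀ x ∈ Φ '' W, pushField Φ Ψ Y x ≠ 0 := by
    rintro Y hY _ ⟨w, hw, rfl⟩ h
    rw [hc.pushField_apply hw] at h
    exact hY w hw (hc.injective_fderiv hw (by rw [h, map_zero]))
  have hs₁ := hc.contDiffOn_pushField h₁
  have hs₂ := hc.contDiffOn_pushField h₂
  refine ⟨Φ '' W, hc.isOpen_image, hp, hc.mapsTo.image_subset, pushField Φ Ψ Y₁,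
    pushField Φ Ψ Y₂, hs₁, hs₂, ?_, ?_, hne hne₁, hne hne₂, hc.isKillingOn_pushField hg hU h₁ hK₁,
    hc.isKillingOn_pushField hg hU h₂ hK₂, ?_⟩
  · rintro _ ⟨w, hw, rfl⟩
    rw [hc.pushField_apply hw, hc.pushField_apply hw, ← map_add, hsum w hw]
  · rintro _ ⟨w, hw, rfl⟩
    rw [hc.pushField_apply hw, hc.pushField_apply hw, ← metricForm_apply, ← metricForm_pullMet,
      horth w hw]
  · rintro _ ⟨w, hw, rfl⟩
    have hw' := mem_image_of_mem Φ hw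
    rw [lieB_related hc hw (hs₁.differentiableAt_top hc.isOpen_image hw')
      (h₁.differentiableAt_top hc.isOpen hw) (hc.pushField_eventually hw Y₁)
      (hs₂.differentiableAt_top hc.isOpen_image hw')
      (h₂.differentiableAt_top hc.isOpen hw) (hc.pushField_eventually hw Y₂), hB w hw, map_zero]

theorem lieMetric_const {n : ℕ} (g : Met n) (c x v w : Pt n) :
    lieMetric g (fun _ => c) x v w = fderiv ℝ (metricForm g) x c v w := by
  simp [lieMetric]

theorem metricForm_tgMet (θ : ℝ → ℝ) (x v w : Pt 3) :
    metricForm (tgMet θ) x v w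
      = v 0 * w 0 + sin (θ (x 0)) ^ 2 * v 1 * w 1 + cos (θ (x 0)) ^ 2 * v 2 * w 2 := by
  simp [metricForm_apply, minner, tgMet, Fin.sum_univ_three]

theorem fderiv_metricForm_of_tgMet {θ : ℝ → ℝ} (hθ : ContDiff ℝ (⊤ : ℕ∞) θ) {h : Met 3}
    (hW : IsOpen W) (hh : IsMetricOn W h) (hW' : ∀ w ∈ W, ∀ i j, h w i j = tgMet θ w i j)
    {w : Pt 3} (hw : w ∈ W) (v a b : Pt 3) :
    fderiv ℝ (metricForm h) w v a b
      = v 0 * (2 * sin (θ (w 0)) * (cos (θ (w 0)) * deriv θ (w 0)) * a 1 * b 1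
        - 2 * cos (θ (w 0)) * (sin (θ (w 0)) * deriv θ (w 0)) * a 2 * b 2) := by
  have e := fderiv_bilin_apply (hh.differentiableAt_metricForm hW hw)
    (differentiableAt_const (c := a) (x := w)) (differentiableAt_const b) v
  simp only [fderiv_fun_const, Pi.zero_apply, _root_.zero_apply, map_zero, add_zero] at e
  rw [← e]
  have h1 : (fun y => metricForm h y a b) =ᶠ[𝓝 w] fun y =>
      a 0 * b 0 + sin (θ (y 0)) ^ 2 * a 1 * b 1 + cos (θ (y 0)) ^ 2 * a 2 * b 2 := by
    filter_upwards [hW.mem_nhds hw] with y hy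
    rw [metricForm_congr (hW' y hy), metricForm_tgMet]
  have hd := (hθ.differentiable (by simp) (w 0)).hasDerivAt
  have h2 : HasDerivAt (fun t => a 0 * b 0 + sin (θ t) ^ 2 * a 1 * b 1 + cos (θ t) ^ 2 * a 2 * b 2)
      (2 * sin (θ (w 0)) * (cos (θ (w 0)) * deriv θ (w 0)) * a 1 * b 1
        - 2 * cos (θ (w 0)) * (sin (θ (w 0)) * deriv θ (w 0)) * a 2 * b 2) (w 0) := by
    refine (((((hd.sin.pow 2).mul_const _).mul_const _).const_add _).add
      (((hd.cos.pow 2).mul_const _).mul_const _)).congr_deriv ?_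
    simp
    ring
  have h3 : HasFDerivAt (fun y : Pt 3 => y 0)
      (ContinuousLinearMap.proj (R := ℝ) 0 : Pt 3 →L[ℝ] ℝ) w :=
    (ContinuousLinearMap.proj (R := ℝ) 0 : Pt 3 →L[ℝ] ℝ).hasFDerivAt
  rw [h1.fderiv_eq]
  have h4 := h2.comp_hasFDerivAt w h3
  rw [show (fun y : Pt 3 => a 0 * b 0 + sin (θ (y 0)) ^ 2 * a 1 * b 1
    + cos (θ (y 0)) ^ 2 * a 2 * b 2) = (fun t => a 0 * b 0 + sin (θ t) ^ 2 * a 1 * b 1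
    + cos (θ t) ^ 2 * a 2 * b 2) ∘ (fun y : Pt 3 => y 0) from rfl, h4.fderiv]
  simp
  ring

theorem AssertionIII.assertionII (hg : IsMetricOn U g) (hU : IsOpen U)
    (h : AssertionIII U g ξ p) : AssertionII U g ξ p := by
  obtain ⟨θ, W, Φ, Ψ, hθ, hW, hΦ, hm, hΦW, hp, hΨ, hl, hpull, hξ⟩ := h
  have hc : IsChart U W Φ Ψ := ⟨hW, hΦ, hm, hΦW, hΨ, hl⟩
  have hh := hc.isMetricOn hg
  have hK : ∀ c : Pt 3, c 0 = 0 → ∀ w ∈ W, ∀ a b,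
      lieMetric (pullMet g Φ) (fun _ => c) w a b = 0 := by
    intro c hc0 w hw a b
    rw [lieMetric_const, fderiv_metricForm_of_tgMet hθ hW hh hpull hw, hc0, zero_mul]
  have hne : ∀ i, stdb 3 i ≠ 0 := fun i h => by simpa [stdb] using congrFun h i
  refine assertionII_of_isChart hg hU hc hp (Y₁ := fun _ => stdb 3 1) (Y₂ := fun _ => stdb 3 2)
    contDiffOn_const contDiffOn_const hξ (fun w hw => ?_) (fun _ _ => hne 1) (fun _ _ => hne 2)
    (hK _ (by simp [stdb])) (hK _ (by simp [stdb])) fun w _ => ?_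
  · rw [metricForm_stdb, hpull w hw]
    simp [tgMet]
  · rw [lieB_eq (differentiableAt_const _) (differentiableAt_const _)]
    simp

/-- The linear embedding `(x, z) ↦ (x, 0, z)`. -/
def sliceEmb : Pt 2 →L[ℝ] Pt 3 :=
  ContinuousLinearMap.pi ![ContinuousLinearMap.proj 0, 0, ContinuousLinearMap.proj 1]

theorem sliceEmb_apply (u : Pt 2) : sliceEmb u = ![u 0, 0, u 1] := by
  ext i
  fin_cases i <;> rfl

theorem linearIndependent_map_stdb {m k : ℕ} {L : Pt m →L[ℝ] Pt k} (hL : Function.Injective L) :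
    LinearIndependent ℝ fun a => L (stdb m a) := by
  have h := (Pi.basisFun ℝ (Fin m)).linearIndependent.map' (L : Pt m →ₗ[ℝ] Pt k)
    (LinearMap.ker_eq_bot.2 hL)
  have e : (fun a => L (stdb m a)) = (L : Pt m →ₗ[ℝ] Pt k) ∘ Pi.basisFun ℝ (Fin m) := by
    ext1 a
    simp [stdb]
  rwa [e]

theorem injective_sliceEmb : Function.Injective sliceEmb := fun v w hvw => by
  rw [sliceEmb_apply, sliceEmb_apply] at hvw
  have h0 := congrFun hvw 0
  have h2 := congrFun hvw 2
  ext i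
  fin_cases i
  · simpa using h0
  · simpa using h2

theorem AssertionIII.assertionI (hg : IsMetricOn U g) (hU : IsOpen U)
    (h : AssertionIII U g ξ p) : AssertionI U g ξ p := by
  obtain ⟨θ, W, Φ, Ψ, hθ, hW, hΦ, hm, hΦW, hp, hΨ, hl, hpull, hξ⟩ := h
  have hc : IsChart U W Φ Ψ := ⟨hW, hΦ, hm, hΦW, hΨ, hl⟩
  have hh := hc.isMetricOn hg
  obtain ⟨w₀, hw₀, rfl⟩ := hp
  have hne : ∀ i, stdb 3 i ≠ 0 := fun i h => by simpa [stdb] using congrFun h i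
  have hform : ∀ w ∈ W, ∀ a b, metricForm (pullMet g Φ) w a b
      = a 0 * b 0 + sin (θ (w 0)) ^ 2 * a 1 * b 1 + cos (θ (w 0)) ^ 2 * a 2 * b 2 :=
    fun w hw a b => by rw [metricForm_congr (hpull w hw), metricForm_tgMet]
  have hsin : ∀ w ∈ W, sin (θ (w 0)) ≠ 0 := fun w hw h => by
    have := hh.metricForm_self_pos hw (hne 1)
    rw [hform w hw, h] at this
    simp [stdb] at this
  have hcos : ∀ w ∈ W, cos (θ (w 0)) ≠ 0 := fun w hw h => by
    have := hh.metricForm_self_pos hw (hne 2)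
    rw [hform w hw, h] at this
    simp [stdb] at this
  set ι : Pt 2 → Pt 3 := fun u => sliceEmb u + w₀ 1 • stdb 3 1 with hι
  have hι0 : ∀ u, ι u 0 = u 0 := fun u => by
    simp only [hι, Pi.add_apply, Pi.smul_apply, sliceEmb_apply]
    simp [stdb]
  have hιs : ContDiff ℝ (⊤ : ℕ∞) ι := sliceEmb.contDiff.add contDiff_const
  have hιd : ∀ u, HasFDerivAt ι sliceEmb u := fun u => sliceEmb.hasFDerivAt.add_const _
  set Y : Pt 2 → Pt 3 := fun u => (sin (θ (u 0)))⁻¹ • stdb 3 1 with hY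
  have hV : IsOpen (ι ⁻¹' W) := hW.preimage hιs.continuous
  have hsin' : ∀ u ∈ ι ⁻¹' W, sin (θ (u 0)) ≠ 0 := fun u hu => by
    have := hsin _ hu
    rwa [hι0] at this
  have hYs : ContDiffOn ℝ (⊤ : ℕ∞) Y (ι ⁻¹' W) := by
    refine ContDiffOn.smul (ContDiffOn.inv ?_ hsin') contDiffOn_const
    exact ((hθ.comp (contDiff_apply ℝ ℝ (0 : Fin 2))).sin).contDiffOn
  have hdF : ∀ u ∈ ι ⁻¹' W, ∀ v,
      fderiv ℝ (fun u => Φ (ι u)) u v = fderiv ℝ Φ (ι u) (sliceEmb v) := fun u hu v => by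
    have := ((hΦ.differentiableAt_top hW hu).hasFDerivAt.comp u (hιd u)).fderiv
    exact congrArg (fun A : Pt 2 →L[ℝ] Pt 3 => A v) this
  have hu₀ : ι ![w₀ 0, w₀ 2] = w₀ := by
    ext i
    simp only [hι, Pi.add_apply, Pi.smul_apply, sliceEmb_apply]
    fin_cases i <;> simp [stdb]
  refine ⟨⟨ι ⁻¹' W, fun u => Φ (ι u), fun u => fderiv ℝ Φ (ι u) (Y u)⟩,
    ⟨hV, hΦ.comp hιs.contDiffOn fun _ h => h, fun u hu => hm hu, fun u hu => ?_,
      ((hΦ.fderiv_top hW).comp hιs.contDiffOn fun _ h => h).clm_apply hYs, fun u hu => ?_,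
      fun u hu a => ?_⟩, fun u hu a => ?_, ![w₀ 0, w₀ 2], ?_, ?_, ?_, 1, ?_⟩
  · change LinearIndependent ℝ fun a => fderiv ℝ (fun u => Φ (ι u)) u (stdb 2 a)
    simp only [hdF u hu]
    refine linearIndependent_map_stdb (L := fderiv ℝ Φ (ι u) ∘L sliceEmb)
      ((hc.injective_fderiv hu).comp injective_sliceEmb)
  · change minner g (Φ (ι u)) (fderiv ℝ Φ (ι u) (Y u)) (fderiv ℝ Φ (ι u) (Y u)) = 1
    rw [← metricForm_apply, ← metricForm_pullMet, hform _ hu, hι0]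
    have := hsin' u hu
    simp [hY, stdb]
    field_simp
  · change minner g (Φ (ι u)) (fderiv ℝ Φ (ι u) (Y u))
      (fderiv ℝ (fun u => Φ (ι u)) u (stdb 2 a)) = 0
    rw [hdF u hu, ← metricForm_apply, ← metricForm_pullMet, hform _ hu]
    simp [hY, stdb, sliceEmb_apply]
  · change covAlong g (fun u => Φ (ι u)) (fun u => fderiv ℝ Φ (ι u) (Y u)) u (stdb 2 a) = 0
    rw [covAlong_related hg hU hc hu (hιd u).differentiableAt (hYs.differentiableAt_top hV hu)
      (Filter.Eventually.of_forall fun _ => rfl) (Filter.Eventually.of_forall fun _ => rfl)]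
    convert map_zero (fderiv ℝ Φ (ι u))
    refine hh.eq_zero_of_metricForm hu fun z => ?_
    have hd := (hθ.differentiable (by simp) (u 0)).hasDerivAt
    have hYd : ∀ v, fderiv ℝ Y u v
        = (-(cos (θ (u 0)) * deriv θ (u 0)) / sin (θ (u 0)) ^ 2 * v 0) • stdb 3 1 := by
      intro v
      have h3 : HasFDerivAt (fun y : Pt 2 => y 0)
          (ContinuousLinearMap.proj (R := ℝ) 0 : Pt 2 →L[ℝ] ℝ) u :=
        (ContinuousLinearMap.proj (R := ℝ) 0 : Pt 2 →L[ℝ] ℝ).hasFDerivAt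
      have h4 := ((hd.sin.inv (hsin' u hu)).comp_hasFDerivAt u h3).smul_const (stdb 3 1)
      have h5 : HasFDerivAt Y _ u := h4
      rw [h5.fderiv]
      simp
    rw [covAlong_eq (hYs.differentiableAt_top hV hu), (hιd u).fderiv, hYd, map_add, add_apply,
      hform _ hu]
    have hk := hh.two_mul_metricForm_christoffelVec hW hu (sliceEmb (stdb 2 a)) (Y u) z
    simp only [fderiv_metricForm_of_tgMet hθ hW hh hpull hu, hι0] at hk
    rw [hι0]
    have := hsin' u hu
    fin_cases a
    · simp [hY, stdb, sliceEmb_apply] at hk ⊢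
      field_simp at hk ⊢
      linarith
    · simp [hY, stdb, sliceEmb_apply] at hk ⊢
      linarith
  · change ι _ ∈ W
    rwa [hu₀]
  · change Φ (ι _) = _
    rw [hu₀]
  · change minner g (Φ w₀) (ξ (Φ w₀)) (fderiv ℝ Φ (ι _) (Y _)) ≠ 0
    rw [hu₀, ← hξ _ hw₀, ← metricForm_apply, ← metricForm_pullMet, hform _ hw₀]
    simpa [hY, stdb] using hsin w₀ hw₀
  · change minner g (Φ w₀) (ξ (Φ w₀)) (fderiv ℝ (fun u => Φ (ι u)) _ (stdb 2 1)) ≠ 0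
    rw [hdF _ (by change ι _ ∈ W; rwa [hu₀]), hu₀, ← hξ _ hw₀, ← metricForm_apply,
      ← metricForm_pullMet, hform _ hw₀]
    simpa [sliceEmb_apply, stdb] using hcos w₀ hw₀

end TrigForm

section FrameChart

open scoped Topology

variable {n : ℕ} {U W W' : Set (Pt n)} {g : Met n} {Φ Ψ : Pt n → Pt n} {p : Pt n}

theorem IsChart.mono (hc : IsChart U W Φ Ψ) (hW' : IsOpen W') (h : W' ⊆ W) :
    IsChart U W' Φ Ψ where
  isOpen := hW'
  contDiffOn := hc.contDiffOn.mono h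
  mapsTo := hc.mapsTo.mono_left h
  isOpen_image := by
    have : Φ '' W' = Φ '' W ∩ Ψ ⁻¹' W' := by
      ext x
      constructor
      · rintro ⟨w, hw, rfl⟩
        exact ⟨mem_image_of_mem Φ (h hw), by rwa [mem_preimage, hc.left_inv w (h hw)]⟩
      · rintro ⟨hx, hx'⟩
        exact ⟨Ψ x, hx', hc.right_inv hx⟩
    rw [this]
    exact hc.contDiffOn_symm.continuousOn.isOpen_inter_preimage hc.isOpen_image hW'
  contDiffOn_symm := hc.contDiffOn_symm.mono (image_mono h)
  left_inv w hw := hc.left_inv w (h hw)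

theorem OpenPartialHomeomorph.isChart (e : OpenPartialHomeomorph (Pt n) (Pt n))
    (he : ContDiffOn ℝ (⊤ : ℕ∞) e e.source) (he' : ContDiffOn ℝ (⊤ : ℕ∞) e.symm e.target)
    (hU : e.target ⊆ U) : IsChart U e.source e e.symm where
  isOpen := e.open_source
  contDiffOn := he
  mapsTo _ hw := hU (e.map_source hw)
  isOpen_image := e.image_source_eq_target ▸ e.open_target
  contDiffOn_symm := e.image_source_eq_target ▸ he'
  left_inv _ hw := e.left_inv hw

theorem bijective_of_frame {ω : Pt n →L[ℝ] Pt n} {E : Fin n → Pt n}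
    (h : ∀ j, ω (E j) = stdb n j) : Function.Bijective ω ∧ ∀ v, v = ∑ j, ω v j • E j := by
  set B : Pt n →ₗ[ℝ] Pt n := Fintype.linearCombination ℝ E
  have h1 : (ω : Pt n →ₗ[ℝ] Pt n) ∘ₗ B = LinearMap.id := by
    ext1 j
    ext1
    simp [B, Fintype.linearCombination_apply, h, stdb, Pi.single_apply]
  have h2 := (LinearMap.comp_eq_id_comm ℝ (Pt n)).1 h1
  refine ⟨⟨Function.LeftInverse.injective (g := B) (LinearMap.congr_fun h2),
    Function.RightInverse.surjective (g := B) (LinearMap.congr_fun h1)⟩, fun v => ?_⟩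
  conv_lhs => rw [← LinearMap.id_apply (R := ℝ) v, ← h2]
  rfl

/-- A commuting frame, with dual coframe `ω`, is locally a coordinate frame. -/
theorem exists_isChart_of_commuting_frame {O : Set (Pt n)} (hO : IsOpen O)
    {E : Fin n → Pt n → Pt n} (hE : ∀ j, ContDiffOn ℝ (⊤ : ℕ∞) (E j) O)
    {ω : Pt n → Pt n →L[ℝ] Pt n} (hω : ContDiffOn ℝ (⊤ : ℕ∞) ω O)
    (hωE : ∀ x ∈ O, ∀ j, ω x (E j x) = stdb n j)
    (hB : ∀ x ∈ O, ∀ i j, lieB (E i) (E j) x = 0) (hp : p ∈ O) :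
    ∃ (W : Set (Pt n)) (Φ Ψ : Pt n → Pt n), IsChart O W Φ Ψ ∧ p ∈ Φ '' W ∧
      ∀ w ∈ W, ∀ j, fderiv ℝ Φ w (stdb n j) = E j (Φ w) := by
  have hsymm : ∀ x ∈ O, ∀ a b, fderiv ℝ ω x a b = fderiv ℝ ω x b a := by
    intro x hx a b
    have hEd := fun j => (hE j).differentiableAt_top hO hx
    have hωd := hω.differentiableAt_top hO hx
    have h1 : ∀ j v, fderiv ℝ ω x v (E j x) = - ω x (fderiv ℝ (E j) x v) := by
      intro j v
      have h2 := fderiv_clm_apply_apply hωd (hEd j) v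
      have h3 : (fun y => ω y (E j y)) =ᶠ[𝓝 x] fun _ => stdb n j := by
        filter_upwards [hO.mem_nhds hx] with y hy using hωE y hy j
      rw [h3.fderiv_eq, fderiv_fun_const, Pi.zero_apply, _root_.zero_apply] at h2
      exact eq_neg_of_add_eq_zero_left h2.symm
    have h4 : ∀ i j, fderiv ℝ ω x (E i x) (E j x) = fderiv ℝ ω x (E j x) (E i x) := by
      intro i j
      rw [h1, h1]
      have h5 := hB x hx i j
      rw [lieB_eq (hEd i) (hEd j), sub_eq_zero] at h5
      rw [h5]
    have h6 := (bijective_of_frame (hωE x hx)).2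
    rw [h6 a, h6 b]
    simp only [map_sum, map_smul, sum_apply, smul_apply, Finset.smul_sum]
    rw [Finset.sum_comm]
    refine Finset.sum_congr rfl fun i _ => Finset.sum_congr rfl fun j _ => ?_
    rw [smul_comm, h4]
  obtain ⟨r, hr, hrO⟩ := Metric.isOpen_iff.1 hO p hp
  obtain ⟨f, hf⟩ := (convex_ball p r).exists_forall_hasFDerivAt_of_fderiv_symmetric
    Metric.isOpen_ball (ω := ω) ((hω.mono hrO).differentiableOn (by simp))
    fun a ha => hsymm a (hrO ha)
  have hfs : ContDiffOn ℝ (⊤ : ℕ∞) f (Metric.ball p r) := by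
    rw [contDiffOn_infty_iff_fderiv_of_isOpen Metric.isOpen_ball]
    exact ⟨fun x hx => (hf x hx).differentiableAt.differentiableWithinAt,
      (hω.mono hrO).congr fun x hx => (hf x hx).fderiv⟩
  have hbij := (bijective_of_frame (hωE p hp)).1
  obtain ⟨e, hpe, heO, hef, hes⟩ := hfs.exists_openPartialHomeomorph Metric.isOpen_ball
    (Metric.mem_ball_self hr)
    (LinearEquiv.ofBijective (ω p : Pt n →ₗ[ℝ] Pt n) hbij).toContinuousLinearEquiv
    (hf p (Metric.mem_ball_self hr))
  have hc : IsChart O e.target e.symm e := by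
    have := e.symm.isChart (U := O) hes (by simpa [hef] using hfs.mono heO)
      (by simpa using heO.trans hrO)
    simpa using this
  refine ⟨e.target, e.symm, e, hc, ⟨e p, e.map_source hpe, e.left_inv hpe⟩, fun w hw j => ?_⟩
  have hx := heO (e.map_target hw)
  have h1 := hc.fderiv_symm_fderiv hw (stdb n j)
  rw [hef, (hf _ hx).fderiv] at h1
  exact (bijective_of_frame (hωE _ (hrO hx))).1.1 (h1.trans (hωE _ (hrO hx) j).symm)

/-- The Leibniz rule for the Lie derivative along a Killing field. -/
theorem fderiv_metricForm_apply_of_lieMetric_eq_zero {x : Pt n} {X Y Z : Pt n → Pt n}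
    (hg : DifferentiableAt ℝ (metricForm g) x) (hX : DifferentiableAt ℝ X x)
    (hY : DifferentiableAt ℝ Y x) (hZ : DifferentiableAt ℝ Z x)
    (hK : ∀ v w, lieMetric g X x v w = 0) :
    fderiv ℝ (fun y => metricForm g y (Y y) (Z y)) x (X x)
      = metricForm g x (lieB X Y x) (Z x) + metricForm g x (Y x) (lieB X Z x) := by
  rw [fderiv_bilin_apply hg hY hZ, lieB_eq hX hY, lieB_eq hX hZ]
  have := hK (Y x) (Z x)
  rw [lieMetric] at this
  simp only [map_sub, sub_apply]
  linarith

theorem lieB_self {x : Pt n} (X : Pt n → Pt n) : lieB X X x = 0 := by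
  ext k
  simp [lieB]

theorem lieB_swap {x : Pt n} (X Y : Pt n → Pt n) : lieB X Y x = - lieB Y X x := by
  ext k
  simp [lieB]

/-- A function on a ball whose derivative vanishes in all coordinate directions but the first
depends only on the first coordinate. -/
theorem eq_of_fderiv_stdb_eq_zero {f : Pt (n + 1) → ℝ} {c : Pt (n + 1)} {r : ℝ}
    (hf : DifferentiableOn ℝ f (Metric.ball c r))
    (h : ∀ w ∈ Metric.ball c r, ∀ j, j ≠ 0 → fderiv ℝ f w (stdb (n + 1) j) = 0)
    {x y : Pt (n + 1)} (hx : x ∈ Metric.ball c r) (hy : y ∈ Metric.ball c r) (hxy : x 0 = y 0) :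
    f x = f y := by
  obtain ⟨z, hz, hzf⟩ := domain_mvt (f := f) (f' := fun x => fderiv ℝ f x)
    (fun x hx => ((hf x hx).differentiableAt
      (Metric.isOpen_ball.mem_nhds hx)).hasFDerivAt.hasFDerivWithinAt)
    (convex_ball c r) hx hy
  have hz' := (convex_ball c r).segment_subset hx hy hz
  rw [map_eq_sum_stdb, Finset.sum_eq_zero, sub_eq_zero] at hzf
  · exact hzf.symm
  · intro j _
    by_cases hj : j = 0
    · simp [hj, hxy]
    · rw [h z hz' j hj, smul_zero]

end FrameChart

section Adapted

open scoped Topology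

variable {U : Set (Pt 3)} {g : Met 3} {ξ : Pt 3 → Pt 3} {p : Pt 3}

theorem exists_notMem_span_pair (x y : Pt 3) : ∃ c, c ∉ Submodule.span ℝ {x, y} := by
  by_contra! h
  have h1 : Submodule.span ℝ {x, y} = ⊤ := Submodule.eq_top_iff'.2 h
  have h2 := finrank_span_finset_le_card (R := ℝ) ({x, y} : Finset (Pt 3))
  rw [Set.finrank, Finset.coe_pair, h1, finrank_top] at h2
  have h3 := h2.trans Finset.card_le_two
  simp at h3

theorem exists_orthogonal_unit_field (hg : IsMetricOn U g) (hU : IsOpen U) {X₁ X₂ : Pt 3 → Pt 3}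
    (h₁ : ContDiffOn ℝ (⊤ : ℕ∞) X₁ U) (h₂ : ContDiffOn ℝ (⊤ : ℕ∞) X₂ U)
    (hn₁ : ∀ x ∈ U, X₁ x ≠ 0) (hn₂ : ∀ x ∈ U, X₂ x ≠ 0)
    (horth : ∀ x ∈ U, metricForm g x (X₁ x) (X₂ x) = 0) (hp : p ∈ U) :
    ∃ (O : Set (Pt 3)) (E : Pt 3 → Pt 3), IsOpen O ∧ p ∈ O ∧ O ⊆ U ∧
      ContDiffOn ℝ (⊤ : ℕ∞) E O ∧ ∀ x ∈ O, metricForm g x (E x) (E x) = 1 ∧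
        metricForm g x (E x) (X₁ x) = 0 ∧ metricForm g x (E x) (X₂ x) = 0 := by
  have hs : ∀ {Y Z : Pt 3 → Pt 3} {V : Set (Pt 3)}, V ⊆ U → ContDiffOn ℝ (⊤ : ℕ∞) Y V →
      ContDiffOn ℝ (⊤ : ℕ∞) Z V →
      ContDiffOn ℝ (⊤ : ℕ∞) (fun x => metricForm g x (Y x) (Z x)) V := fun hV hY hZ =>
    contDiffOn_metricForm_apply hg contDiffOn_id hV hY hZ
  have ha := fun x hx => hg.metricForm_self_pos hx (hn₁ x hx)
  have hb := fun x hx => hg.metricForm_self_pos hx (hn₂ x hx)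
  obtain ⟨c, hc⟩ := exists_notMem_span_pair (X₁ p) (X₂ p)
  set v : Pt 3 → Pt 3 := fun x => c
    - (metricForm g x (X₁ x) c / metricForm g x (X₁ x) (X₁ x)) • X₁ x
    - (metricForm g x (X₂ x) c / metricForm g x (X₂ x) (X₂ x)) • X₂ x with hv
  have hvs : ContDiffOn ℝ (⊤ : ℕ∞) v U :=
    (contDiffOn_const.sub (((hs subset_rfl h₁ contDiffOn_const).div (hs subset_rfl h₁ h₁)
      fun x hx => (ha x hx).ne').smul h₁)).sub (((hs subset_rfl h₂ contDiffOn_const).div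
      (hs subset_rfl h₂ h₂) fun x hx => (hb x hx).ne').smul h₂)
  have hvp : v p ≠ 0 := by
    intro h
    simp only [hv, sub_sub, sub_eq_zero] at h
    exact hc (Submodule.mem_span_pair.2 ⟨_, _, h.symm⟩)
  have hv₁ : ∀ x ∈ U, metricForm g x (v x) (X₁ x) = 0 := by
    intro x hx
    rw [hg.metricForm_comm]
    simp only [hv, map_sub, map_smul, smul_eq_mul, horth x hx]
    have := (ha x hx).ne'
    field_simp
    ring
  have hv₂ : ∀ x ∈ U, metricForm g x (v x) (X₂ x) = 0 := by
    intro x hx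
    rw [hg.metricForm_comm]
    simp only [hv, map_sub, map_smul, smul_eq_mul, hg.metricForm_comm x (X₂ x) (X₁ x), horth x hx]
    have := (hb x hx).ne'
    field_simp
    ring
  have hOU : U ∩ v ⁻¹' {0}ᶜ ⊆ U := inter_subset_left
  have hvv : ∀ x ∈ U ∩ v ⁻¹' {0}ᶜ, 0 < metricForm g x (v x) (v x) := fun x hx =>
    hg.metricForm_self_pos hx.1 hx.2
  refine ⟨U ∩ v ⁻¹' {0}ᶜ, fun x => (√(metricForm g x (v x) (v x)))⁻¹ • v x,
    hvs.continuousOn.isOpen_inter_preimage hU isOpen_compl_singleton, ⟨hp, hvp⟩, hOU, ?_,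
    fun x hx => ⟨?_, ?_, ?_⟩⟩
  · exact (((hs hOU (hvs.mono hOU) (hvs.mono hOU)).sqrt fun x hx => (hvv x hx).ne').inv
      fun x hx => (sqrt_pos.2 (hvv x hx)).ne').smul (hvs.mono hOU)
  · have h := hvv x hx
    simp only [map_smul, smul_apply, smul_eq_mul]
    rw [← mul_assoc, ← mul_inv, mul_self_sqrt h.le, inv_mul_cancel₀ h.ne']
  · simp only [map_smul, smul_apply, hv₁ x hx.1, smul_zero]
  · simp only [map_smul, smul_apply, hv₂ x hx.1, smul_zero]

theorem exists_angle {A : ℝ → ℝ} {c r : ℝ} (hr : 0 < r)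
    (hA : ContDiffOn ℝ (⊤ : ℕ∞) A (Metric.ball c r))
    (hpos : ∀ t ∈ Metric.ball c r, 0 < A t) (hlt : ∀ t ∈ Metric.ball c r, A t < 1) :
    ∃ θ : ℝ → ℝ, ContDiff ℝ (⊤ : ℕ∞) θ ∧ ∃ r' > 0, r' ≤ r ∧
      ∀ t ∈ Metric.ball c r', sin (θ t) ^ 2 = A t := by
  have h1 : ContDiffOn ℝ (⊤ : ℕ∞) (fun t => arcsin √(A t)) (Metric.ball c r) := by
    intro t ht
    have hs : √(A t) < 1 := by
      rw [sqrt_lt' one_pos, one_pow]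
      exact hlt t ht
    have hs0 : √(A t) ≠ -1 := ne_of_gt (by linarith [sqrt_pos.2 (hpos t ht)])
    exact ContDiffAt.comp_contDiffWithinAt (g := arcsin) (f := fun t => √(A t)) t
      (contDiffAt_arcsin hs0 hs.ne) ((hA.sqrt fun x hx => (hpos x hx).ne') t ht)
  obtain ⟨θ, hθ, -, heq⟩ := h1.exists_contDiff_hasCompactSupport_eventuallyEq Metric.isOpen_ball
    (Metric.mem_ball_self hr)
  obtain ⟨r₁, hr₁, hball⟩ := Metric.eventually_nhds_iff_ball.1 heq
  refine ⟨θ, hθ, min r r₁, lt_min hr hr₁, min_le_left _ _, fun t ht => ?_⟩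
  have ht' := Metric.ball_subset_ball (min_le_left r r₁) ht
  rw [hball t (Metric.ball_subset_ball (min_le_right r r₁) ht), sin_arcsin, sq_sqrt (hpos t ht').le]
  · linarith [sqrt_nonneg (A t)]
  · rw [sqrt_le_iff, one_pow]
    exact ⟨zero_le_one, (hlt t ht').le⟩

theorem AssertionII.assertionIII (hg : IsMetricOn U g) (hξu : IsUnitOn U g ξ)
    (h : AssertionII U g ξ p) : AssertionIII U g ξ p := by
  obtain ⟨W₀, hW₀, hpW, hWU, X₁, X₂, h₁, h₂, hsum, horth, hn₁, hn₂, hK₁, hK₂, hB⟩ := h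
  have hgW : IsMetricOn W₀ g :=
    ⟨fun i j => (hg.1 i j).mono hWU, hg.2.1, fun x hx => hg.2.2 x (hWU hx)⟩
  simp only [← metricForm_apply] at horth
  rw [hgW.isKillingOn_iff hW₀ subset_rfl fun x hx => h₁.differentiableAt_top hW₀ hx] at hK₁
  rw [hgW.isKillingOn_iff hW₀ subset_rfl fun x hx => h₂.differentiableAt_top hW₀ hx] at hK₂
  obtain ⟨O, E₀, hO, hpO, hOW, hE₀, hE₀m⟩ :=
    exists_orthogonal_unit_field hgW hW₀ h₁ h₂ hn₁ hn₂ horth hpW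
  set a : Pt 3 → ℝ := fun x => metricForm g x (X₁ x) (X₁ x) with ha
  set b : Pt 3 → ℝ := fun x => metricForm g x (X₂ x) (X₂ x) with hb
  have hapos : ∀ x ∈ W₀, 0 < a x := fun x hx => hgW.metricForm_self_pos hx (hn₁ x hx)
  have hbpos : ∀ x ∈ W₀, 0 < b x := fun x hx => hgW.metricForm_self_pos hx (hn₂ x hx)
  have horth' : ∀ x ∈ W₀, metricForm g x (X₂ x) (X₁ x) = 0 := fun x hx => by
    rw [hgW.metricForm_comm, horth x hx]
  have hab : ∀ x ∈ W₀, a x + b x = 1 := by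
    intro x hx
    have := hξu x (hWU hx)
    rw [← hsum x hx, ← metricForm_apply] at this
    simp only [map_add, add_apply, horth x hx, horth' x hx] at this
    linarith
  have hsm : ∀ {Y Z : Pt 3 → Pt 3}, ContDiffOn ℝ (⊤ : ℕ∞) Y O →
      ContDiffOn ℝ (⊤ : ℕ∞) Z O →
      ContDiffOn ℝ (⊤ : ℕ∞) (fun x => metricForm g x (Y x) (Z x)) O := fun hY hZ =>
    contDiffOn_metricForm_apply hgW contDiffOn_id hOW hY hZ
  have h₁O := h₁.mono hOW
  have h₂O := h₂.mono hOW
  have has : ContDiffOn ℝ (⊤ : ℕ∞) a O := hsm h₁O h₁O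
  have hbs : ContDiffOn ℝ (⊤ : ℕ∞) b O := hsm h₂O h₂O
  set E : Fin 3 → Pt 3 → Pt 3 := ![E₀, X₁, X₂] with hEdef
  have hE : ∀ j, ContDiffOn ℝ (⊤ : ℕ∞) (E j) O := by
    intro j
    fin_cases j
    exacts [hE₀, h₁O, h₂O]
  set ω : Pt 3 → Pt 3 →L[ℝ] Pt 3 := fun x => ContinuousLinearMap.pi
    ![metricForm g x (E₀ x), (a x)⁻¹ • metricForm g x (X₁ x), (b x)⁻¹ • metricForm g x (X₂ x)]
    with hωdef
  have hω : ContDiffOn ℝ (⊤ : ℕ∞) ω O := by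
    rw [contDiffOn_clm_apply]
    intro y
    rw [contDiffOn_pi]
    intro i
    fin_cases i
    · exact hsm hE₀ contDiffOn_const
    · exact (has.inv fun x hx => (hapos x (hOW hx)).ne').mul (hsm h₁O contDiffOn_const)
    · exact (hbs.inv fun x hx => (hbpos x (hOW hx)).ne').mul (hsm h₂O contDiffOn_const)
  have hωa : ∀ x y, ω x y = ![metricForm g x (E₀ x) y, (a x)⁻¹ * metricForm g x (X₁ x) y,
      (b x)⁻¹ * metricForm g x (X₂ x) y] := by
    intro x y
    ext i
    fin_cases i <;> rfl
  have hωE : ∀ x ∈ O, ∀ j, ω x (E j x) = stdb 3 j := by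
    intro x hx j
    obtain ⟨e1, e2, e3⟩ := hE₀m x hx
    have ha0 := (hapos x (hOW hx)).ne'
    have hb0 := (hbpos x (hOW hx)).ne'
    rw [hωa]
    ext i
    fin_cases j
    · have e2' := e2
      have e3' := e3
      rw [hgW.metricForm_comm] at e2' e3'
      fin_cases i <;> simp [hEdef, stdb, e1, e2', e3']
    · fin_cases i <;> simp [hEdef, stdb, e2, horth' x (hOW hx)]
      exact inv_mul_cancel₀ ha0
    · fin_cases i <;> simp [hEdef, stdb, e3, horth x (hOW hx)]
      exact inv_mul_cancel₀ hb0
  have hE₀B : ∀ X : Pt 3 → Pt 3, ContDiffOn ℝ (⊤ : ℕ∞) X O →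
      (∀ x ∈ O, ∀ v w, lieMetric g X x v w = 0) → (∀ x ∈ O, lieB X X₁ x = 0) →
      (∀ x ∈ O, lieB X X₂ x = 0) → ∀ x ∈ O, lieB X E₀ x = 0 := by
    intro X hX hK hX₁ hX₂ x hx
    have hd := hgW.differentiableAt_metricForm hW₀ (hOW hx)
    have hL : ∀ Z c, ContDiffOn ℝ (⊤ : ℕ∞) Z O → (∀ y ∈ O, metricForm g y (E₀ y) (Z y) = c) →
        metricForm g x (lieB X E₀ x) (Z x) + metricForm g x (E₀ x) (lieB X Z x) = 0 := by
      intro Z c hZ hc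
      rw [← fderiv_metricForm_apply_of_lieMetric_eq_zero hd (hX.differentiableAt_top hO hx)
        (hE₀.differentiableAt_top hO hx) (hZ.differentiableAt_top hO hx) (hK x hx)]
      have : (fun y => metricForm g y (E₀ y) (Z y)) =ᶠ[𝓝 x] fun _ => c := by
        filter_upwards [hO.mem_nhds hx] with y hy using hc y hy
      rw [this.fderiv_eq, fderiv_fun_const]
      rfl
    have l0 := hL E₀ 1 hE₀ fun y hy => (hE₀m y hy).1
    have l1 := hL X₁ 0 h₁O fun y hy => (hE₀m y hy).2.1
    have l2 := hL X₂ 0 h₂O fun y hy => (hE₀m y hy).2.2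
    rw [hX₁ x hx, map_zero, add_zero, hgW.metricForm_comm] at l1
    rw [hX₂ x hx, map_zero, add_zero, hgW.metricForm_comm] at l2
    rw [hgW.metricForm_comm x (lieB X E₀ x), ← two_mul] at l0
    refine (bijective_of_frame (hωE x hx)).1.1 ?_
    rw [map_zero, hωa, l1, l2, mul_zero, mul_zero, (mul_eq_zero.1 l0).resolve_left two_ne_zero]
    ext i
    fin_cases i <;> rfl
  have hB' : ∀ x ∈ W₀, lieB X₂ X₁ x = 0 := fun x hx => by rw [lieB_swap, hB x hx, neg_zero]
  have hB₁ := hE₀B X₁ h₁O (fun x hx => hK₁ x (hOW hx)) (fun x _ => lieB_self X₁)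
    fun x hx => hB x (hOW hx)
  have hB₂ := hE₀B X₂ h₂O (fun x hx => hK₂ x (hOW hx)) (fun x hx => hB' x (hOW hx))
    fun x _ => lieB_self X₂
  have hEB : ∀ x ∈ O, ∀ i j, lieB (E i) (E j) x = 0 := by
    intro x hx i j
    fin_cases i <;> fin_cases j
    exacts [lieB_self _, (lieB_swap _ _).trans (neg_eq_zero.2 (hB₁ x hx)),
      (lieB_swap _ _).trans (neg_eq_zero.2 (hB₂ x hx)), hB₁ x hx, lieB_self _, hB x (hOW hx),
      hB₂ x hx, hB' x (hOW hx), lieB_self _]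
  obtain ⟨W₁, Φ, Ψ, hc, ⟨w₀, hw₀, hΦp⟩, hframe⟩ :=
    exists_isChart_of_commuting_frame hO hE hω hωE hEB hpO
  obtain ⟨r, hr, hrW⟩ := Metric.isOpen_iff.1 hc.isOpen w₀ hw₀
  set α : Pt 3 → ℝ := fun w => a (Φ w) with hα
  have hαs : ContDiffOn ℝ (⊤ : ℕ∞) α (Metric.ball w₀ r) :=
    has.comp (hc.contDiffOn.mono hrW) (hc.mapsTo.mono_left hrW)
  have hαd : ∀ w ∈ Metric.ball w₀ r, ∀ j, j ≠ 0 → fderiv ℝ α w (stdb 3 j) = 0 := by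
    intro w hw j hj
    have hx := hc.mapsTo (hrW hw)
    have h3 := fderiv_comp w (has.differentiableAt_top hO hx)
      (hc.contDiffOn.differentiableAt_top hc.isOpen (hrW hw))
    have hd := hgW.differentiableAt_metricForm hW₀ (hOW hx)
    have hd₁ := h₁.differentiableAt_top hW₀ (hOW hx)
    have hd₂ := h₂.differentiableAt_top hW₀ (hOW hx)
    have h4 : fderiv ℝ α w (stdb 3 j) = fderiv ℝ a (Φ w) (E j (Φ w)) := by
      rw [← hframe w (hrW hw) j]
      exact congrArg (fun A : Pt 3 →L[ℝ] ℝ => A (stdb 3 j)) h3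
    rw [h4]
    fin_cases j
    · exact absurd rfl hj
    · refine (fderiv_metricForm_apply_of_lieMetric_eq_zero hd hd₁ hd₁ hd₁
        (hK₁ _ (hOW hx))).trans ?_
      rw [lieB_self]
      simp
    · refine (fderiv_metricForm_apply_of_lieMetric_eq_zero hd hd₂ hd₁ hd₁
        (hK₂ _ (hOW hx))).trans ?_
      rw [hB' _ (hOW hx)]
      simp
  set γ : ℝ → Pt 3 := fun t => w₀ + (t - w₀ 0) • stdb 3 0 with hγ
  have hγ0 : ∀ t, γ t 0 = t := fun t => by simp [hγ, stdb]
  have hγm : MapsTo γ (Metric.ball (w₀ 0) r) (Metric.ball w₀ r) := by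
    intro t ht
    rw [Metric.mem_ball, dist_eq_norm] at ht ⊢
    simp only [hγ, add_sub_cancel_left, norm_smul, stdb, Pi.norm_single, norm_one, mul_one]
    exact ht
  have hγs : ContDiff ℝ (⊤ : ℕ∞) γ :=
    contDiff_const.add ((contDiff_id.sub contDiff_const).smul contDiff_const)
  have hlt : ∀ x ∈ W₀, a x < 1 := fun x hx => by linarith [hab x hx, hbpos x hx]
  obtain ⟨θ, hθ, r', hr', hrr, hsin⟩ := exists_angle hr (hαs.comp hγs.contDiffOn hγm)
    (fun t ht => hapos _ (hOW (hc.mapsTo (hrW (hγm ht)))))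
    (fun t ht => hlt _ (hOW (hc.mapsTo (hrW (hγm ht)))))
  have hrr' := Metric.ball_subset_ball (x := w₀) hrr
  have hc' := hc.mono (W' := Metric.ball w₀ r') Metric.isOpen_ball (hrr'.trans hrW)
  have hsinα : ∀ w ∈ Metric.ball w₀ r', sin (θ (w 0)) ^ 2 = a (Φ w) := by
    intro w hw
    have hw0 : w 0 ∈ Metric.ball (w₀ 0) r' :=
      lt_of_le_of_lt (dist_le_pi_dist w w₀ 0) hw
    rw [hsin _ hw0]
    exact eq_of_fderiv_stdb_eq_zero (hαs.differentiableOn (by simp)) hαd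
      (hγm (Metric.ball_subset_ball hrr hw0)) (hrr' hw) (hγ0 _)
  refine ⟨θ, Metric.ball w₀ r', Φ, Ψ, hθ, hc'.isOpen, hc'.contDiffOn,
    hc'.mapsTo.mono_right (hOW.trans hWU), hc'.isOpen_image, ⟨w₀, Metric.mem_ball_self hr', hΦp⟩,
    hc'.contDiffOn_symm, hc'.left_inv, fun w hw i j => ?_, fun w hw => ?_⟩
  · have hwW := hrW (hrr' hw)
    have hx := hc.mapsTo hwW
    have hcos : cos (θ (w 0)) ^ 2 = b (Φ w) := by
      rw [cos_sq', hsinα w hw]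
      linarith [hab _ (hOW hx)]
    obtain ⟨e1, e2, e3⟩ := hE₀m _ hx
    have e2' := e2
    have e3' := e3
    rw [hgW.metricForm_comm] at e2' e3'
    rw [pullMet, hframe w hwW, hframe w hwW, ← metricForm_apply]
    fin_cases i <;> fin_cases j <;>
      simp [tgMet, hEdef, hsinα w hw, hcos, e1, e2, e3, e2', e3', horth _ (hOW hx),
        horth' _ (hOW hx), ha, hb]
  · have hwW := hrW (hrr' hw)
    rw [map_add, hframe w hwW, hframe w hwW, ← hsum _ (hOW (hc.mapsTo hwW))]
    rfl

end Adapted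

section Slice

open scoped Topology

/-- The linear embedding `(x, y) ↦ (x, y, 0)`. -/
def planeEmb : Pt 2 →L[ℝ] Pt 3 :=
  ContinuousLinearMap.pi ![ContinuousLinearMap.proj 0, ContinuousLinearMap.proj 1, 0]

/-- The linear projection `(x, y, z) ↦ (x, y)`. -/
def planeProj : Pt 3 →L[ℝ] Pt 2 :=
  ContinuousLinearMap.pi ![ContinuousLinearMap.proj 0, ContinuousLinearMap.proj 1]

theorem planeProj_planeEmb (u : Pt 2) : planeProj (planeEmb u) = u := by
  ext i
  fin_cases i <;> rfl

theorem planeProj_stdb_two : planeProj (stdb 3 2) = 0 := by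
  ext i
  fin_cases i <;> simp [planeProj, stdb]

theorem planeEmb_apply_two (u : Pt 2) : planeEmb u 2 = 0 := rfl

theorem planeEmb_planeProj_add (w : Pt 3) : planeEmb (planeProj w) + w 2 • stdb 3 2 = w := by
  ext i
  fin_cases i <;> simp [planeProj, planeEmb, stdb]

theorem planeEmb_planeProj {w : Pt 3} (hw : w 2 = 0) : planeEmb (planeProj w) = w := by
  conv_rhs => rw [← planeEmb_planeProj_add w, hw, zero_smul, add_zero]

theorem planeEmb_planeProj_mem_ball {u : Pt 2} {r : ℝ} {w : Pt 3}
    (hw : w ∈ Metric.ball (planeEmb u) r) :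
    planeEmb (planeProj w) ∈ Metric.ball (planeEmb u) r := by
  refine lt_of_le_of_lt ((dist_pi_le_iff dist_nonneg).2 fun i => ?_) hw
  fin_cases i
  · exact dist_le_pi_dist w (planeEmb u) 0
  · exact dist_le_pi_dist w (planeEmb u) 1
  · exact (dist_self (0 : ℝ)).trans_le dist_nonneg

/-- Adapted coordinates obtained by flowing a transverse surface along a vector field. -/
theorem exists_isChart_of_transverse {U : Set (Pt 3)} {ξ : Pt 3 → Pt 3} {V : Set (Pt 2)}
    {F : Pt 2 → Pt 3} {u : Pt 2} (hU : IsOpen U) (hξ : ContDiffOn ℝ (⊤ : ℕ∞) ξ U) (hV : IsOpen V)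
    (hF : ContDiffOn ℝ (⊤ : ℕ∞) F V) (hu : u ∈ V) (hFu : F u ∈ U)
    (hinj : Function.Injective (fderiv ℝ F u)) {l : Pt 3 →L[ℝ] ℝ}
    (hl : ∀ v, l (fderiv ℝ F u v) = 0) (hlξ : l (ξ (F u)) ≠ 0) :
    ∃ (r : ℝ) (Φ Ψ : Pt 3 → Pt 3), 0 < r ∧ IsChart U (Metric.ball (planeEmb u) r) Φ Ψ ∧
      (∀ v, planeEmb v ∈ Metric.ball (planeEmb u) r → v ∈ V ∧ Φ (planeEmb v) = F v) ∧
      ∀ w ∈ Metric.ball (planeEmb u) r, fderiv ℝ Φ w (stdb 3 2) = ξ (Φ w) := by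
  obtain ⟨ξ₁, hξ₁, hξ₁c, hξ₁e⟩ :=
    hξ.exists_contDiff_hasCompactSupport_eventuallyEq hU hFu
  obtain ⟨O', hO'ξ, hO', hpO'⟩ := eventually_nhds_iff.1 hξ₁e
  obtain ⟨O, φ, hO, hpO, hφ, hφ0, hφt⟩ := exists_contDiffOn_flow hξ₁ hξ₁c (F u)
  set Q : Pt 3 → Pt 3 × ℝ := fun w => (F (planeProj w), w 2) with hQ
  have hQs : ContDiffOn ℝ (⊤ : ℕ∞) Q (planeProj ⁻¹' V) :=
    (hF.comp planeProj.contDiff.contDiffOn fun _ h => h).prodMk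
      (contDiff_apply ℝ ℝ (2 : Fin 3)).contDiffOn
  have hD₁ : IsOpen (planeProj ⁻¹' V ∩ Q ⁻¹' O) :=
    hQs.continuousOn.isOpen_inter_preimage (hV.preimage planeProj.continuous) hO
  set f : Pt 3 → Pt 3 := fun w => φ (Q w) with hf
  have hfs₁ : ContDiffOn ℝ (⊤ : ℕ∞) f (planeProj ⁻¹' V ∩ Q ⁻¹' O) :=
    hφ.comp (hQs.mono inter_subset_left) fun _ h => h.2
  set D : Set (Pt 3) := (planeProj ⁻¹' V ∩ Q ⁻¹' O) ∩ f ⁻¹' (U ∩ O') with hDdef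
  have hD : IsOpen D := hfs₁.continuousOn.isOpen_inter_preimage hD₁ (hU.inter hO')
  have hfs : ContDiffOn ℝ (⊤ : ℕ∞) f D := hfs₁.mono inter_subset_left
  have hQι : ∀ v, Q (planeEmb v) = (F v, 0) := fun v => by
    simp only [hQ, planeProj_planeEmb, planeEmb_apply_two]
  have hfι : ∀ v, (F v, (0 : ℝ)) ∈ O → f (planeEmb v) = F v := fun v hv => by
    simp only [hf, hQι]
    exact hφ0 _ hv rfl
  have huD : planeEmb u ∈ D := by
    refine ⟨⟨?_, ?_⟩, ?_⟩
    · rwa [mem_preimage, planeProj_planeEmb]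
    · rwa [mem_preimage, hQι]
    · rw [mem_preimage, hfι u hpO]
      exact ⟨hFu, hpO'⟩
  have hf3 : ∀ w ∈ D, fderiv ℝ f w (stdb 3 2) = ξ (f w) := by
    intro w hw
    have h1 := (hfs.differentiableAt_top hD hw).hasFDerivAt.hasLineDerivAt (stdb 3 2)
    have h2 : HasDerivAt (fun t : ℝ => φ ((Q w).1, w 2 + t)) (ξ₁ (φ (Q w))) 0 := by
      have := hφt _ hw.1.2
      have h3 : (Q w).2 = w 2 + 0 := (add_zero _).symm
      rw [h3] at this
      exact this.comp_const_add (w 2) 0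
    rw [← hO'ξ (f w) hw.2.2]
    refine h1.unique (h2.congr_of_eventuallyEq (Filter.Eventually.of_forall fun t => ?_))
    simp only [hf, hQ, map_add, map_smul, planeProj_stdb_two]
    simp [stdb]
  have hfF : ∀ v, fderiv ℝ f (planeEmb u) (planeEmb v) = fderiv ℝ F u v := by
    intro v
    have h1 := (hfs.differentiableAt_top hD huD).hasFDerivAt.comp u planeEmb.hasFDerivAt
    have h2 : F =ᶠ[𝓝 u] f ∘ planeEmb := by
      filter_upwards [(hD.preimage planeEmb.continuous).mem_nhds huD] with v hv
      refine (hfι v ?_).symm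
      rw [← hQι]
      exact hv.1.2
    rw [h2.fderiv_eq, h1.fderiv]
    rfl
  have hinjf : Function.Injective (fderiv ℝ f (planeEmb u)) := by
    rw [injective_iff_map_eq_zero]
    intro v hv
    rw [← planeEmb_planeProj_add v, map_add, map_smul, hfF, hf3 _ huD, hfι u hpO] at hv
    have h2 : v 2 = 0 := by
      have := congrArg l hv
      rw [map_add, hl, zero_add, map_smul, map_zero, smul_eq_mul] at this
      exact (mul_eq_zero.1 this).resolve_right hlξ
    rw [h2, zero_smul, add_zero] at hv
    rw [← planeEmb_planeProj_add v, h2, (injective_iff_map_eq_zero _).1 hinj _ hv]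
    simp
  obtain ⟨e, hue, heD, hef, hes⟩ := hfs.exists_openPartialHomeomorph hD huD
    (LinearEquiv.ofInjectiveEndo (fderiv ℝ f (planeEmb u) : Pt 3 →ₗ[ℝ] Pt 3)
      hinjf).toContinuousLinearEquiv (hfs.differentiableAt_top hD huD).hasFDerivAt
  obtain ⟨r, hr, hball⟩ := Metric.isOpen_iff.1 e.open_source _ hue
  have hc : IsChart U e.source e e.symm := by
    refine e.isChart (by rw [hef]; exact hfs.mono heD) hes ?_
    rw [← e.image_source_eq_target, hef]
    rintro _ ⟨w, hw, rfl⟩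
    exact (heD hw).2.1
  rw [hef] at hc
  refine ⟨r, f, e.symm, hr, hc.mono Metric.isOpen_ball hball, fun v hv => ?_,
    fun w hw => hf3 w (heD (hball hw))⟩
  have := (heD (hball hv)).1
  rw [mem_inter_iff, mem_preimage, mem_preimage, hQι, planeProj_planeEmb] at this
  exact ⟨this.1, hfι v this.2⟩

end Slice

section SliceKilling

open scoped Topology

variable {W : Set (Pt 3)} {h : Met 3} {Y : Pt 3 → Pt 3}

theorem fderiv_comp_planeProj {E : Type*} [NormedAddCommGroup E] [NormedSpace ℝ E]
    {f : Pt 2 → E} {w : Pt 3} (hf : DifferentiableAt ℝ f (planeProj w)) (v : Pt 3) :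
    fderiv ℝ (fun y => f (planeProj y)) w v = fderiv ℝ f (planeProj w) (planeProj v) := by
  have := (hf.hasFDerivAt.comp w planeProj.hasFDerivAt).fderiv
  exact congrArg (fun A : Pt 3 →L[ℝ] E => A v) this

theorem map_eq_planeEmb_add {E : Type*} [NormedAddCommGroup E] [NormedSpace ℝ E]
    (A : Pt 3 →L[ℝ] E) (hA : A (stdb 3 2) = 0) (v : Pt 3) : A v = A (planeEmb (planeProj v)) := by
  conv_lhs => rw [← planeEmb_planeProj_add v, map_add, map_smul, hA, smul_zero, add_zero]

/-- If `∂₂` is a unit Killing field, then so is the normal component of `∂₂` relative to a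
foliation by parallel planes, provided it is `∂₂`-invariant and preserves the metric of the
planes. -/
theorem IsMetricOn.lieMetric_eq_zero_of_planes (hh : IsMetricOn W h) (hW : IsOpen W)
    (hinv : ∀ w ∈ W, fderiv ℝ (metricForm h) w (stdb 3 2) = 0)
    (hunit : ∀ w ∈ W, metricForm h w (stdb 3 2) (stdb 3 2) = 1)
    (hY : ContDiffOn ℝ (⊤ : ℕ∞) Y W) (hYinv : ∀ w ∈ W, fderiv ℝ Y w (stdb 3 2) = 0)
    (hY2 : ∀ w ∈ W, Y w 2 = 1) (hYt : ∀ w ∈ W, ∀ t : Pt 3, t 2 = 0 → metricForm h w (Y w) t = 0)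
    (htan : ∀ w ∈ W, ∀ s t : Pt 3, s 2 = 0 → t 2 = 0 → lieMetric h Y w s t = 0) {w : Pt 3}
    (hw : w ∈ W) (v z : Pt 3) : lieMetric h Y w v z = 0 := by
  have hd := hh.differentiableAt_metricForm hW hw
  have hdY := hY.differentiableAt_top hW hw
  have hsymm : ∀ a b, lieMetric h Y w a b = lieMetric h Y w b a := fun a b => by
    simp only [lieMetric, hh.metricForm_comm w _ b, hh.metricForm_comm w a,
      hh.fderiv_metricForm_comm hW hw _ a b]
    ring
  have hadd : ∀ a b c, lieMetric h Y w (a + b) c = lieMetric h Y w a c + lieMetric h Y w b c := by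
    intro a b c
    simp only [lieMetric, map_add, add_apply]
    ring
  have hsmul : ∀ (r : ℝ) a c, lieMetric h Y w (r • a) c = r * lieMetric h Y w a c := by
    intro r a c
    simp only [lieMetric, map_smul, smul_apply, smul_eq_mul]
    ring
  have hDY2 : ∀ a, fderiv ℝ Y w a 2 = 0 := by
    intro a
    rw [← fderiv_apply_coord hdY]
    have : (fun y => Y y 2) =ᶠ[𝓝 w] fun _ => 1 := by
      filter_upwards [hW.mem_nhds hw] with y hy using hY2 y hy
    rw [this.fderiv_eq, fderiv_fun_const]
    rfl
  have hconst : ∀ {A B : Pt 3 → Pt 3} {c : ℝ}, DifferentiableAt ℝ A w → DifferentiableAt ℝ B w →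
      (∀ y ∈ W, metricForm h y (A y) (B y) = c) → ∀ a,
      fderiv ℝ (metricForm h) w a (A w) (B w) + metricForm h w (fderiv ℝ A w a) (B w)
        + metricForm h w (A w) (fderiv ℝ B w a) = 0 := by
    intro A B c hA hB hc a
    rw [← fderiv_bilin_apply hd hA hB]
    have : (fun y => metricForm h y (A y) (B y)) =ᶠ[𝓝 w] fun _ => c := by
      filter_upwards [hW.mem_nhds hw] with y hy using hc y hy
    rw [this.fderiv_eq, fderiv_fun_const]
    rfl
  have h33 : lieMetric h Y w (stdb 3 2) (stdb 3 2) = 0 := by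
    have := hconst (differentiableAt_const (stdb 3 2)) (differentiableAt_const (stdb 3 2)) hunit
      (Y w)
    simpa [lieMetric, hYinv w hw] using this
  have htY : ∀ t : Pt 3, t 2 = 0 → lieMetric h Y w (Y w) t = 0 := by
    intro t ht
    have h1 := hconst hdY (differentiableAt_const t) (fun y hy => hYt y hy t ht)
      (stdb 3 2 - Y w)
    have h2 := hYt w hw _ (hDY2 t)
    simp only [map_sub, hYinv w hw, hinv w hw, fderiv_fun_const, zero_sub, Pi.zero_apply,
      _root_.zero_apply, map_zero, sub_apply, neg_apply, map_neg] at h1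
    simp only [lieMetric, h2]
    linarith
  have ht3 : ∀ t : Pt 3, t 2 = 0 → lieMetric h Y w (stdb 3 2) t = 0 := by
    intro t ht
    have h1 := hadd (Y w) (stdb 3 2 - Y w) t
    rwa [add_sub_cancel, htY t ht, htan w hw (stdb 3 2 - Y w) t (by simp [hY2 w hw, stdb]) ht,
      add_zero] at h1
  have hp := planeEmb_apply_two
  have h3 : ∀ b, lieMetric h Y w (stdb 3 2) b = 0 := fun b => by
    rw [hsymm, ← planeEmb_planeProj_add b, hadd, hsmul, h33, hsymm, ht3 _ (hp _)]
    ring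
  rw [← planeEmb_planeProj_add v, hadd, hsmul, h3, hsymm, ← planeEmb_planeProj_add z, hadd, hsmul,
    h3, htan w hw _ _ (hp _) (hp _)]
  ring

theorem IsMetricOn.metricForm_eq_planeEmb (hh : IsMetricOn W h) (hW : IsOpen W)
    (hconv : Convex ℝ W) (hinv : ∀ w ∈ W, fderiv ℝ (metricForm h) w (stdb 3 2) = 0) {w : Pt 3}
    (hw : w ∈ W) (hw' : planeEmb (planeProj w) ∈ W) :
    metricForm h w = metricForm h (planeEmb (planeProj w)) := by
  refine metricForm_congr fun i j => ?_
  rw [← metricForm_stdb h, ← metricForm_stdb h]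
  have hd : ∀ y ∈ W, HasFDerivAt (fun y => metricForm h y (stdb 3 i) (stdb 3 j))
      (fderiv ℝ (fun y => metricForm h y (stdb 3 i) (stdb 3 j)) y) y := fun y hy =>
    (((hh.differentiableAt_metricForm hW hy).clm_apply (differentiableAt_const _)).clm_apply
      (differentiableAt_const _)).hasFDerivAt
  obtain ⟨z, hz, hzf⟩ := domain_mvt (fun y hy => (hd y hy).hasFDerivWithinAt) hconv hw' hw
  have hzW := hconv.segment_subset hw' hw hz
  rw [sub_eq_of_eq_add' (planeEmb_planeProj_add w).symm,
    fderiv_bilin_apply (hh.differentiableAt_metricForm hW hzW) (differentiableAt_const _)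
      (differentiableAt_const _), map_smul, hinv z hzW] at hzf
  simpa [sub_eq_zero] using hzf

/-- A field orthogonal to a totally geodesic surface preserves the metric of the surface. -/
theorem IsMetricOn.lieMetric_planeEmb (hh : IsMetricOn W h) (hW : IsOpen W) {n : Pt 2 → Pt 3}
    {ν : Pt 2 → ℝ} {u : Pt 2} (hu : planeEmb u ∈ W) (hn : DifferentiableAt ℝ n u)
    (hν : DifferentiableAt ℝ ν u)
    (hnt : ∀ v, metricForm h (planeEmb u) (n u) (planeEmb v) = 0)
    (hcov : ∀ a, covAlong h planeEmb n u (stdb 2 a) = 0)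
    (s t : Pt 2) :
    lieMetric h (fun w => ν (planeProj w) • n (planeProj w)) (planeEmb u)
      (planeEmb s) (planeEmb t) = 0 := by
  have hK : ∀ s b, 2 * metricForm h (planeEmb u) (fderiv ℝ n u s) b
      + fderiv ℝ (metricForm h) (planeEmb u) (planeEmb s) (n u) b
      + fderiv ℝ (metricForm h) (planeEmb u) (n u) (planeEmb s) b
      - fderiv ℝ (metricForm h) (planeEmb u) b (planeEmb s) (n u) = 0 := by
    intro s b
    have h1 : ∀ a, 2 * metricForm h (planeEmb u) (fderiv ℝ n u (stdb 2 a)) b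
        + fderiv ℝ (metricForm h) (planeEmb u) (planeEmb (stdb 2 a)) (n u) b
        + fderiv ℝ (metricForm h) (planeEmb u) (n u) (planeEmb (stdb 2 a)) b
        - fderiv ℝ (metricForm h) (planeEmb u) b (planeEmb (stdb 2 a)) (n u) = 0 := by
      intro a
      have h2 := hh.two_mul_metricForm_christoffelVec hW hu (planeEmb (stdb 2 a)) (n u) b
      have h3 := hcov a
      rw [covAlong_eq hn, ContinuousLinearMap.fderiv] at h3
      have h4 := congrArg (fun x => metricForm h (planeEmb u) x b) h3
      simp only [map_add, add_apply, map_zero, _root_.zero_apply] at h4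
      linarith
    rw [← sum_smul_stdb s, Fin.sum_univ_two]
    simp only [map_add, map_smul, add_apply, smul_apply, smul_eq_mul]
    linear_combination s 0 * h1 0 + s 1 * h1 1
  have hD : ∀ s, fderiv ℝ (fun w => ν (planeProj w) • n (planeProj w)) (planeEmb u) (planeEmb s)
      = ν u • fderiv ℝ n u s + fderiv ℝ ν u s • n u := by
    intro s
    have h1 : DifferentiableAt ℝ (fun u => ν u • n u) (planeProj (planeEmb u)) := by
      rw [planeProj_planeEmb]
      exact hν.smul hn
    rw [fderiv_comp_planeProj h1, planeProj_planeEmb, planeProj_planeEmb, fderiv_fun_smul hν hn]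
    rfl
  have hs := hK s (planeEmb t)
  have ht := hK t (planeEmb s)
  simp only [lieMetric, hD, planeProj_planeEmb, map_add, map_smul, add_apply, smul_apply,
    smul_eq_mul, hnt, hh.metricForm_comm (planeEmb u) (planeEmb s)]
  rw [hh.fderiv_metricForm_comm hW hu (planeEmb t) (planeEmb s) (n u),
    hh.fderiv_metricForm_comm hW hu (n u) (planeEmb t) (planeEmb s)] at *
  rw [hh.fderiv_metricForm_comm hW hu (planeEmb t) (n u) (planeEmb s),
    hh.fderiv_metricForm_comm hW hu (planeEmb s) (planeEmb t) (n u)] at *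
  linear_combination ν u / 2 * (hs + ht)

end SliceKilling

section Main

open scoped Topology

variable {U W : Set (Pt 3)} {g h : Met 3} {ξ : Pt 3 → Pt 3} {p : Pt 3}

theorem IsMetricOn.lieMetric_eq_planeEmb (hh : IsMetricOn W h) (hW : IsOpen W)
    (hconv : Convex ℝ W) (hinv : ∀ w ∈ W, fderiv ℝ (metricForm h) w (stdb 3 2) = 0)
    (hP : ∀ w ∈ W, planeEmb (planeProj w) ∈ W) {y : Pt 2 → Pt 3} {w : Pt 3} (hw : w ∈ W)
    (hy : DifferentiableAt ℝ y (planeProj w)) (a b : Pt 3) :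
    lieMetric h (fun w => y (planeProj w)) w a b
      = lieMetric h (fun w => y (planeProj w)) (planeEmb (planeProj w)) a b := by
  have hd := hh.differentiableAt_metricForm hW (hP w hw)
  have hk : metricForm h =ᶠ[𝓝 w] fun w => metricForm h (planeEmb (planeProj w)) := by
    filter_upwards [hW.mem_nhds hw] with z hz
    exact hh.metricForm_eq_planeEmb hW hconv hinv hz (hP z hz)
  have hDk : ∀ v, fderiv ℝ (metricForm h) w v
      = fderiv ℝ (metricForm h) (planeEmb (planeProj w)) v := by
    intro v
    have h1 := HasFDerivAt.comp (G := Pt 3 →L[ℝ] Pt 3 →L[ℝ] ℝ) w hd.hasFDerivAt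
      (planeEmb ∘L planeProj).hasFDerivAt
    rw [hk.fderiv_eq, map_eq_planeEmb_add (fderiv ℝ (metricForm h) (planeEmb (planeProj w)))
      (hinv _ (hP w hw)) v]
    exact congrArg (fun A : Pt 3 →L[ℝ] Pt 3 →L[ℝ] Pt 3 →L[ℝ] ℝ => A v) h1.fderiv
  have hy' : DifferentiableAt ℝ y (planeProj (planeEmb (planeProj w))) := by
    rwa [planeProj_planeEmb]
  simp only [lieMetric, hDk, fderiv_comp_planeProj hy, fderiv_comp_planeProj hy',
    planeProj_planeEmb, hk.self_of_nhds]

theorem Hyp.TotallyGeodesic.assertionII (hg : IsMetricOn U g) (hU : IsOpen U)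
    (hξ : ContDiffOn ℝ (⊤ : ℕ∞) ξ U) (hξu : IsUnitOn U g ξ) (hξk : IsKillingOn U g ξ) {S : Hyp 2}
    (hS : S.IsRegular U g) (hT : S.TotallyGeodesic g) {c : Fin 2}
    (hνV : ∀ u ∈ S.V, minner g (S.F u) (ξ (S.F u)) (S.N u) ≠ 0)
    (hcV : ∀ u ∈ S.V, minner g (S.F u) (ξ (S.F u)) (fderiv ℝ S.F u (stdb 2 c)) ≠ 0) {u₀ : Pt 2}
    (hu₀ : u₀ ∈ S.V) : AssertionII U g ξ (S.F u₀) := by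
  obtain ⟨V, F, N⟩ := S
  obtain ⟨hV, hF, hFU, hli, hN, hNN, hNF⟩ := hS
  dsimp only at *
  simp only [← metricForm_apply] at hνV hcV hNN hNF
  have hNF' : ∀ u ∈ V, ∀ v, metricForm g (F u) (N u) (fderiv ℝ F u v) = 0 := by
    intro u hu v
    rw [map_eq_sum_stdb (fderiv ℝ F u) v, map_sum]
    exact Finset.sum_eq_zero fun a _ => by rw [map_smul, hNF u hu, smul_zero]
  have hinj : Function.Injective (fderiv ℝ F u₀) := by
    rw [injective_iff_map_eq_zero]
    intro v hv
    rw [map_eq_sum_stdb] at hv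
    ext i
    exact Fintype.linearIndependent_iff.1 (hli u₀ hu₀) v hv i
  obtain ⟨r, Φ, Ψ, hr, hc, hslice, hΦ3⟩ := exists_isChart_of_transverse hU hξ hV hF hu₀
    (hFU u₀ hu₀) hinj (hNF' u₀ hu₀) (by rw [hg.metricForm_comm]; exact hνV u₀ hu₀)
  set W := Metric.ball (planeEmb u₀) r with hWdef
  have hW : IsOpen W := Metric.isOpen_ball
  have hconv : Convex ℝ W := convex_ball _ _
  have hP : ∀ w ∈ W, planeEmb (planeProj w) ∈ W := fun w hw => planeEmb_planeProj_mem_ball hw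
  set h := pullMet g Φ with hhdef
  have hh : IsMetricOn W h := hc.isMetricOn hg
  set V₀ : Set (Pt 2) := planeEmb ⁻¹' W with hV₀def
  have hV₀ : IsOpen V₀ := hW.preimage planeEmb.continuous
  have hV₀V : V₀ ⊆ V := fun v hv => (hslice v hv).1
  have hΦF : ∀ v ∈ V₀, Φ (planeEmb v) = F v := fun v hv => (hslice v hv).2
  have hFim : MapsTo F V₀ (Φ '' W) := fun v hv => ⟨_, hv, hΦF v hv⟩
  have hDF : ∀ u ∈ V₀, ∀ v, fderiv ℝ Φ (planeEmb u) (planeEmb v) = fderiv ℝ F u v := by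
    intro u hu v
    have h1 := (hc.contDiffOn.differentiableAt_top hW hu).hasFDerivAt.comp u planeEmb.hasFDerivAt
    have h2 : F =ᶠ[𝓝 u] Φ ∘ planeEmb := by
      filter_upwards [hV₀.mem_nhds hu] with v hv using (hΦF v hv).symm
    rw [h2.fderiv_eq, h1.fderiv]
    rfl
  set n : Pt 2 → Pt 3 := fun u => fderiv ℝ Ψ (F u) (N u) with hndef
  have hn : ContDiffOn ℝ (⊤ : ℕ∞) n V₀ :=
    ((hc.contDiffOn_symm.fderiv_top hc.isOpen_image).comp (hF.mono hV₀V) hFim).clm_apply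
      (hN.mono hV₀V)
  have hDn : ∀ u ∈ V₀, fderiv ℝ Φ (planeEmb u) (n u) = N u := by
    intro u hu
    simp only [hndef, ← hΦF u hu]
    exact hc.fderiv_fderiv_symm hu _
  have hinv : ∀ w ∈ W, fderiv ℝ (metricForm h) w (stdb 3 2) = 0 := by
    intro w hw
    ext a b
    rw [← lieMetric_const h (stdb 3 2) w a b, ← lieMetric_related hg hU hc hw
      (hξ.differentiableAt_top hU (hc.mapsTo hw)) (differentiableAt_const _)]
    · exact (hg.isKillingOn_iff hU subset_rfl fun x hx => hξ.differentiableAt_top hU hx).1 hξk _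
        (hc.mapsTo hw) _ _
    · filter_upwards [hW.mem_nhds hw] with y hy using (hΦ3 y hy).symm
  have hunit : ∀ w ∈ W, metricForm h w (stdb 3 2) (stdb 3 2) = 1 := by
    intro w hw
    rw [metricForm_pullMet, hΦ3 w hw, metricForm_apply]
    exact hξu _ (hc.mapsTo hw)
  have hkP : ∀ w ∈ W, metricForm h w = metricForm h (planeEmb (planeProj w)) := fun w hw =>
    hh.metricForm_eq_planeEmb hW hconv hinv hw (hP w hw)
  have hnt : ∀ u ∈ V₀, ∀ v, metricForm h (planeEmb u) (n u) (planeEmb v) = 0 := by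
    intro u hu v
    rw [metricForm_pullMet, hDn u hu, hDF u hu, hΦF u hu]
    exact hNF' u (hV₀V hu) v
  have hnt' : ∀ u ∈ V₀, ∀ t : Pt 3, t 2 = 0 → metricForm h (planeEmb u) (n u) t = 0 :=
    fun u hu t ht => by rw [← planeEmb_planeProj ht, hnt u hu]
  set ν : Pt 2 → ℝ := fun u => metricForm h (planeEmb u) (n u) (stdb 3 2) with hνdef
  have hν : ContDiffOn ℝ (⊤ : ℕ∞) ν V₀ := contDiffOn_metricForm_apply hh
    planeEmb.contDiff.contDiffOn (fun _ hu => hu) hn contDiffOn_const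
  have hn2 : ∀ u ∈ V₀, ν u * n u 2 = 1 := by
    intro u hu
    have h1 : metricForm h (planeEmb u) (n u) (n u) = 1 := by
      rw [metricForm_pullMet, hDn u hu, hΦF u hu]
      exact hNN u (hV₀V hu)
    conv_lhs at h1 => arg 2; rw [← planeEmb_planeProj_add (n u)]
    rw [map_add, hnt u hu, map_smul, zero_add, smul_eq_mul] at h1
    rw [mul_comm]
    exact h1
  set y : Pt 2 → Pt 3 := fun u => ν u • n u with hydef
  have hy : ContDiffOn ℝ (⊤ : ℕ∞) y V₀ := hν.smul hn
  set Y : Pt 3 → Pt 3 := fun w => y (planeProj w) with hYdef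
  have hPV : MapsTo planeProj W V₀ := hP
  have hY : ContDiffOn ℝ (⊤ : ℕ∞) Y W := hy.comp planeProj.contDiff.contDiffOn hPV
  have hYinv : ∀ w ∈ W, fderiv ℝ Y w (stdb 3 2) = 0 := fun w hw => by
    rw [hYdef, fderiv_comp_planeProj (hy.differentiableAt_top hV₀ (hPV hw)), planeProj_stdb_two,
      map_zero]
  have hY2 : ∀ w ∈ W, Y w 2 = 1 := fun w hw => hn2 _ (hPV hw)
  have hYt : ∀ w ∈ W, ∀ t : Pt 3, t 2 = 0 → metricForm h w (Y w) t = 0 := by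
    intro w hw t ht
    rw [hkP w hw, hYdef, hydef]
    simp only [map_smul, smul_apply, hnt' _ (hPV hw) t ht, smul_zero]
  have hcov : ∀ u ∈ V₀, ∀ a, covAlong h planeEmb n u (stdb 2 a) = 0 := by
    intro u hu a
    have h1 := hT u (hV₀V hu) a
    dsimp only at h1
    rw [covAlong_related hg hU hc (ι := planeEmb) hu planeEmb.differentiableAt
      (hn.differentiableAt_top hV₀ hu)
      (by filter_upwards [hV₀.mem_nhds hu] with v hv using (hΦF v hv).symm)
      (by filter_upwards [hV₀.mem_nhds hu] with v hv using (hDn v hv).symm)] at h1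
    exact (injective_iff_map_eq_zero _).1 (hc.injective_fderiv hu) _ h1
  have htan : ∀ w ∈ W, ∀ s t : Pt 3, s 2 = 0 → t 2 = 0 → lieMetric h Y w s t = 0 := by
    intro w hw s t hs ht
    rw [hYdef, hh.lieMetric_eq_planeEmb hW hconv hinv hP hw
      (hy.differentiableAt_top hV₀ (hPV hw)), ← planeEmb_planeProj hs, ← planeEmb_planeProj ht]
    exact hh.lieMetric_planeEmb hW (hP w hw) (hn.differentiableAt_top hV₀ (hPV hw))
      (hν.differentiableAt_top hV₀ (hPV hw)) (hnt _ (hPV hw)) (hcov _ (hPV hw)) _ _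
  have hK : ∀ w ∈ W, ∀ a b, lieMetric h Y w a b = 0 := fun w hw a b =>
    hh.lieMetric_eq_zero_of_planes hW hinv hunit hY hYinv hY2 hYt htan hw a b
  have hdZ : ∀ w ∈ W, fderiv ℝ (fun w => stdb 3 2 - Y w) w = - fderiv ℝ Y w := fun w _ => by
    rw [fderiv_const_sub]
  have hZ2 : ∀ w ∈ W, (stdb 3 2 - Y w) 2 = 0 := fun w hw => by
    rw [Pi.sub_apply, hY2 w hw]
    simp [stdb]
  refine assertionII_of_isChart hg hU hc ⟨_, Metric.mem_ball_self hr, hΦF u₀ ?_⟩ hY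
    (contDiffOn_const.sub hY) (Y₂ := fun w => stdb 3 2 - Y w) (fun w hw => ?_)
    (fun w hw => hYt w hw _ (hZ2 w hw)) (fun w hw h0 => ?_) (fun w hw h0 => ?_) hK
    (fun w hw a b => ?_) fun w hw => ?_
  · exact Metric.mem_ball_self hr
  · rw [add_sub_cancel, hΦ3 w hw]
  · simpa [h0] using hY2 w hw
  · have hu := hPV hw
    refine hcV _ (hV₀V hu) ?_
    rw [← hΦF _ hu, ← hΦ3 _ (hP w hw), ← hDF _ hu, ← metricForm_pullMet,
      ← hkP w hw, sub_eq_zero.1 h0]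
    exact hYt w hw _ (planeEmb_apply_two _)
  · have h1 := hK w hw a b
    simp only [lieMetric, hdZ w hw, map_sub, ← hhdef, hinv w hw, sub_apply, _root_.zero_apply,
      neg_apply,
      map_neg] at h1 ⊢
    linarith
  · rw [lieB_eq (hY.differentiableAt_top hW hw)
      ((hY.differentiableAt_top hW hw).const_sub _), hdZ w hw, map_sub, hYinv w hw]
    simp

theorem AssertionI.assertionII (hg : IsMetricOn U g) (hU : IsOpen U)
    (hξ : ContDiffOn ℝ (⊤ : ℕ∞) ξ U) (hξu : IsUnitOn U g ξ) (hξk : IsKillingOn U g ξ)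
    (h : AssertionI U g ξ p) : AssertionII U g ξ p := by
  obtain ⟨⟨V, F, N⟩, ⟨hV, hF, hFU, hli, hN, hNN, hNF⟩, hT, u, hu, rfl, hνu, c, hcu⟩ := h
  dsimp only [Hyp.TotallyGeodesic] at *
  have hξF := hξ.comp hF hFU
  have hs : ∀ {Z : Pt 2 → Pt 3}, ContDiffOn ℝ (⊤ : ℕ∞) Z V →
      ContinuousOn (fun u => minner g (F u) (ξ (F u)) (Z u)) V := fun hZ => by
    simp only [← metricForm_apply]
    exact (contDiffOn_metricForm_apply hg hF hFU hξF hZ).continuousOn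
  have ho₁ := (hs hN).isOpen_inter_preimage hV (isOpen_compl_singleton (x := (0 : ℝ)))
  have hDs := (hF.fderiv_top hV).clm_apply (contDiffOn_const (c := stdb 2 c))
  have ho₂ := (hs hDs).isOpen_inter_preimage hV (isOpen_compl_singleton (x := (0 : ℝ)))
  have ho := ho₁.inter ho₂
  set V' := (V ∩ (fun u => minner g (F u) (ξ (F u)) (N u)) ⁻¹' {0}ᶜ)
    ∩ (V ∩ (fun u => minner g (F u) (ξ (F u)) (fderiv ℝ F u (stdb 2 c))) ⁻¹' {0}ᶜ)
  have hsub : V' ⊆ V := fun u hu => hu.1.1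
  exact Hyp.TotallyGeodesic.assertionII (S := ⟨V', F, N⟩) (c := c) hg hU hξ hξu hξk
    ⟨ho, hF.mono hsub, fun u hu => hFU u (hsub hu), fun u hu => hli u (hsub hu), hN.mono hsub,
      fun u hu => hNN u (hsub hu), fun u hu => hNF u (hsub hu)⟩ (fun u hu => hT u (hsub hu))
    (fun u hu => hu.1.2) (fun u hu => hu.2.2) ⟨⟨hu, hνu⟩, hu, hcu⟩

end Main

/-- Theorem 2 (3).  For a Riemannian three-manifold with a unit
Killing field `ξ` and a point `p`, the assertions (i), (ii), (iii) are equivalent. -/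
theorem statement11 (U : Set (Pt 3)) (hU : IsOpen U)
    (g : Met 3) (hg : IsMetricOn U g)
    (ξ : Pt 3 → Pt 3) (hξs : ContDiffOn ℝ (⊤ : ℕ∞) ξ U)
    (hξu : IsUnitOn U g ξ) (hξk : IsKillingOn U g ξ)
    (p : Pt 3) (hp : p ∈ U) :
    (AssertionI U g ξ p ↔ AssertionII U g ξ p) ∧
    (AssertionII U g ξ p ↔ AssertionIII U g ξ p) := by
  exact ⟨⟨AssertionI.assertionII hg hU hξs hξu hξk,
    fun h => (h.assertionIII hg hξu).assertionI hg hU⟩,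
   ⟨AssertionII.assertionIII hg hξu, AssertionIII.assertionII hg hU⟩⟩
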